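/- Let F ∈ R^{l×m} be of normal rank r with d_r(F) associated to d_1^{p} d_2^{q}, where d_1 = x_1 − f_1(x_2,...,x_n), d_2 = x_2 − f_2(x_3,...,x_n) for some f_1 ∈ K[x_2,...,x_n], f_2 ∈ K[x_3,...,x_n], and p, q are positive integers. Then F is equivalent to its Smith normal form B = [[D, 0_{r×(m−r)}],[0_{(l−r)×r}, 0_{(l−r)×(m−r)}]], where D = diag(d_1^{r_1}d_2^{s_1},..., d_1^{r_r}d_2^{s_r}) with d_i(F) associated to d_1^{p_i}d_2^{q_i}, p_0 = q_0 = 0, r_i = p_i − p_{i−1}, s_i = q_i − q_{i−1}, if and only if J_k(F) = R for all k = 1,2,...,r. -/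

import Mathlib

open Matrix MvPolynomial

/-- The set of `k × k` minors of a matrix: determinants of submatrices obtained by
choosing `k` rows and `k` columns. -/
def minorsSet {R : Type*} [CommRing R] {l m : ℕ} (k : ℕ)
    (F : Matrix (Fin l) (Fin m) R) : Set R :=
  { d | ∃ (ri : Fin k → Fin l) (ci : Fin k → Fin m),
      Function.Injective ri ∧ Function.Injective ci ∧ d = (F.submatrix ri ci).det }

/-- `d` is a greatest common divisor of the `k × k` minors of `F`. -/
def IsGcdMinors {R : Type*} [CommRing R] {l m : ℕ} (k : ℕ)
    (F : Matrix (Fin l) (Fin m) R) (d : R) : Prop :=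
  (∀ a ∈ minorsSet k F, d ∣ a) ∧ ∀ e : R, (∀ a ∈ minorsSet k F, e ∣ a) → e ∣ d

/-- `J_k(F) = R` : the ideal generated by the reduced `k`-th order minors
(the `k × k` minors divided by their g.c.d.) is the unit ideal. -/
def JEqTop {R : Type*} [CommRing R] {l m : ℕ} (k : ℕ)
    (F : Matrix (Fin l) (Fin m) R) : Prop :=
  ∃ d : R, IsGcdMinors k F d ∧ Ideal.span { b : R | d * b ∈ minorsSet k F } = ⊤

/-- The normal rank of a polynomial matrix: its rank over the fraction field. -/
noncomputable def normalRank {K : Type*} [Field K] {n l m : ℕ}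
    (F : Matrix (Fin l) (Fin m) (MvPolynomial (Fin n) K)) : ℕ :=
  (F.map (algebraMap (MvPolynomial (Fin n) K)
      (FractionRing (MvPolynomial (Fin n) K)))).rank

/-- Equivalence of matrices: `G = M * F * N` with `M`, `N` unimodular
(i.e. with determinant a unit, a nonzero constant). -/
def MatEquiv {R : Type*} [CommRing R] {l m : ℕ}
    (F G : Matrix (Fin l) (Fin m) R) : Prop :=
  ∃ (M : Matrix (Fin l) (Fin l) R) (N : Matrix (Fin m) (Fin m) R),
    IsUnit M.det ∧ IsUnit N.det ∧ G = M * F * N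

/-- A matrix is zero left prime (ZLP) if its maximal (row-size) order minors
generate the unit ideal. -/
def ZLP {R : Type*} [CommRing R] {l m : ℕ} (F : Matrix (Fin l) (Fin m) R) : Prop :=
  Ideal.span (minorsSet l F) = ⊤

open scoped TensorProduct

theorem exists_dual_lift {B C P : Type*} [CommRing B] [CommRing C] [Algebra B C]
    (hC : Function.Surjective (algebraMap B C)) [AddCommGroup P] [Module B P]
    [Module.Projective B P] (l : C ⊗[B] P →ₗ[C] C) :
    ∃ θ : P →ₗ[B] B, ∀ p, algebraMap B C (θ p) = l (1 ⊗ₜ p) := by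
  obtain ⟨θ, hθ⟩ := Module.projective_lifting_property (Algebra.linearMap B C)
    (l.restrictScalars B ∘ₗ (TensorProduct.mk B C P 1)) hC
  exact ⟨θ, fun p => by simpa using LinearMap.congr_fun hθ p⟩

theorem exists_one_tmul_eq {B C P : Type*} [CommRing B] [CommRing C] [Algebra B C]
    (hC : Function.Surjective (algebraMap B C)) [AddCommGroup P] [Module B P]
    (y : C ⊗[B] P) : ∃ q : P, (1 : C) ⊗ₜ[B] q = y := by
  induction y with
  | zero => exact ⟨0, by simp⟩
  | tmul c p =>
    obtain ⟨b, rfl⟩ := hC c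
    exact ⟨b • p, by rw [TensorProduct.tmul_smul, TensorProduct.smul_tmul', Algebra.smul_def,
      mul_one]⟩
  | add x y hx hy =>
    obtain ⟨p, rfl⟩ := hx
    obtain ⟨q, rfl⟩ := hy
    exact ⟨p + q, by rw [TensorProduct.tmul_add]⟩

theorem exists_isCoprime_relation {C : Type*} [CommRing C] [IsDomain C] [IsPrincipalIdealRing C]
    (a b : C) : ∃ s t : C, IsCoprime s t ∧ s * a + t * b = 0 := by
  by_cases h0 : a = 0
  · exact ⟨1, 0, isCoprime_one_left, by simp [h0]⟩
  obtain ⟨g, hg⟩ := IsPrincipalIdealRing.principal (Ideal.span {a, b})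
  obtain ⟨a', ha⟩ : g ∣ a := Ideal.mem_span_singleton.1
    (show a ∈ Ideal.span {g} from (hg ▸ Ideal.subset_span (by simp) : a ∈ Submodule.span C {g}))
  obtain ⟨b', hb⟩ : g ∣ b := Ideal.mem_span_singleton.1
    (show b ∈ Ideal.span {g} from (hg ▸ Ideal.subset_span (by simp) : b ∈ Submodule.span C {g}))
  have hgm : g ∈ Ideal.span {a, b} := hg ▸ Submodule.mem_span_singleton_self g
  obtain ⟨u, v, huv⟩ := Ideal.mem_span_pair.1 hgm
  have hg0 : g ≠ 0 := by rintro rfl; exact h0 (by simpa using ha)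
  refine ⟨b', -a', ⟨v, -u, mul_left_cancel₀ hg0 ?_⟩, ?_⟩
  · linear_combination huv - u * ha - v * hb
  · rw [ha, hb]; ring

/-- Over a principal ideal domain, every vector of a free module of rank at least two is
annihilated by a surjective functional. -/
theorem exists_functional_of_two_le_finrank {C M : Type*} [CommRing C] [IsDomain C]
    [IsPrincipalIdealRing C] [AddCommGroup M] [Module C M] [Module.Free C M] [Module.Finite C M]
    (h : 2 ≤ Module.finrank C M) (x : M) :
    ∃ (l : M →ₗ[C] C) (y : M), l x = 0 ∧ l y = 1 := by
  have b := Module.finBasis C M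
  set i : Fin (Module.finrank C M) := ⟨0, by omega⟩
  set j : Fin (Module.finrank C M) := ⟨1, by omega⟩
  have hij : i ≠ j := by simp [i, j]
  obtain ⟨s, t, ⟨u, v, huv⟩, hx⟩ := exists_isCoprime_relation (b.repr x i) (b.repr x j)
  refine ⟨s • b.coord i + t • b.coord j, u • b i + v • b j, by simpa using hx, ?_⟩
  simp [hij, hij.symm]
  linear_combination huv

section Reduction

variable {B C P : Type*} [CommRing B] [CommRing C] [IsDomain C]
  [Algebra B C] [AddCommGroup P] [Module B P] {r : ℕ}
  {f : B} {φ : (Fin r → B) →ₗ[B] P} {ψ : P →ₗ[B] (Fin r → B)}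

theorem finrank_baseChange_le [Module.Finite B P] (hf : algebraMap B C f ≠ 0)
    (h : ∀ c, ψ (φ c) = f • c) :
    r ≤ Module.finrank C (C ⊗[B] P) := by
  have key : ψ.baseChange C ∘ₗ φ.baseChange C = algebraMap B C f • LinearMap.id := by
    refine TensorProduct.AlgebraTensorModule.curry_injective (LinearMap.ext_ring
      (LinearMap.ext fun c => ?_))
    simp [h, algebraMap_smul]
  have hinj : Function.Injective (φ.baseChange C) := by
    have : Function.Injective (ψ.baseChange C ∘ₗ φ.baseChange C) := by
      rw [key]
      intro a b hab
      exact smul_right_injective _ hf hab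
    exact Function.Injective.of_comp (f := ψ.baseChange C) (by simpa using this)
  have := (algebraMap B C).domain_nontrivial
  simpa only [Module.finrank_baseChange, Module.finrank_fin_fun] using
    LinearMap.finrank_le_finrank_of_injective hinj

theorem le_finrank_baseChange [Module.Projective B P] (hf : algebraMap B C f ≠ 0)
    (h : ∀ p, φ (ψ p) = f • p) :
    Module.finrank C (C ⊗[B] P) ≤ r := by
  have key : φ.baseChange C ∘ₗ ψ.baseChange C = algebraMap B C f • LinearMap.id := by
    refine TensorProduct.AlgebraTensorModule.curry_injective (LinearMap.ext_ring
      (LinearMap.ext fun c => ?_))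
    simp [h, algebraMap_smul]
  have hinj : Function.Injective (ψ.baseChange C) := by
    have : Function.Injective (φ.baseChange C ∘ₗ ψ.baseChange C) := by
      rw [key]
      intro a b hab
      exact smul_right_injective _ hf hab
    exact Function.Injective.of_comp (f := φ.baseChange C) (by simpa using this)
  have := (algebraMap B C).domain_nontrivial
  simpa only [Module.finrank_baseChange, Module.finrank_fin_fun] using
    LinearMap.finrank_le_finrank_of_injective hinj

theorem exists_reduction_of_two_le [IsPrincipalIdealRing C] [Module.Finite B P]
    [Module.Projective B P] (hC : Function.Surjective (algebraMap B C)) (hr : 2 ≤ r)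
    (hf : algebraMap B C f ≠ 0) (h : ∀ c, ψ (φ c) = f • c) (x : P) :
    ∃ (q : P) (θ : P →ₗ[B] B), algebraMap B C (θ x) = 0 ∧ algebraMap B C (θ q) = 1 := by
  obtain ⟨l, y, hx, hy⟩ := exists_functional_of_two_le_finrank
    (hr.trans (finrank_baseChange_le hf h)) ((1 : C) ⊗ₜ[B] x)
  obtain ⟨θ, hθ⟩ := exists_dual_lift hC l
  obtain ⟨q, rfl⟩ := exists_one_tmul_eq hC y
  exact ⟨q, θ, by rw [hθ, hx], by rw [hθ, hy]⟩

theorem exists_reduction_of_eq_one [IsPrincipalIdealRing C] [Module.Finite B P]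
    [Module.Projective B P] {φ : (Fin 1 → B) →ₗ[B] P}
    {ψ : P →ₗ[B] (Fin 1 → B)}
    (hC : Function.Surjective (algebraMap B C))
    (hf : algebraMap B C f ≠ 0) (h : ∀ c, ψ (φ c) = f • c) (h' : ∀ p, φ (ψ p) = f • p) :
    ∃ (q : P) (θ : P →ₗ[B] B), algebraMap B C (θ q) = 1 ∧ algebraMap B C (ψ q 0) ≠ 0 ∧
      ∀ p, algebraMap B C (ψ p 0) = algebraMap B C (θ p) * algebraMap B C (ψ q 0) := by
  have hrk : Module.finrank C (C ⊗[B] P) = 1 :=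
    le_antisymm (le_finrank_baseChange hf h') (finrank_baseChange_le hf h)
  have b := Module.basisUnique (R := C) (M := C ⊗[B] P) (Fin 1) hrk
  obtain ⟨θ, hθ⟩ := exists_dual_lift hC (b.coord 0)
  obtain ⟨q, hq⟩ := exists_one_tmul_eq hC (b 0)
  let L : C ⊗[B] P →ₗ[C] C := TensorProduct.AlgebraTensorModule.rid B C C ∘ₗ
    ((LinearMap.proj 0 ∘ₗ ψ).baseChange C)
  have hL : ∀ p, L (1 ⊗ₜ p) = algebraMap B C (ψ p 0) := fun p => by
    simp [L, Algebra.smul_def]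
  have hmul : ∀ p, algebraMap B C (ψ p 0) = algebraMap B C (θ p) * algebraMap B C (ψ q 0) := by
    intro p
    rw [← hL, ← hL, hθ, hq]
    conv_lhs => rw [← b.sum_repr ((1 : C) ⊗ₜ[B] p)]
    simp
  refine ⟨q, θ, by rw [hθ, hq]; simp, fun h0 => hf ?_, hmul⟩
  have := hmul (φ (fun _ => 1))
  rw [h, h0] at this
  simpa using this

end Reduction

open scoped TensorProduct

section Horrocks

open Polynomial IsLocalRing

variable {A : Type*} [CommRing A] [IsLocalRing A]

theorem isLocalRing_eq_top_of_monic {O : Ideal A[X]} {g u : A[X]} (hg : g.Monic) (hgO : g ∈ O)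
    (hu : u ∈ O) (hu1 : u.map (residue A) = 1) : O = ⊤ := by
  by_contra hO
  obtain ⟨M, hM, hOM⟩ := Ideal.exists_le_maximal O hO
  have hint : Algebra.IsIntegral A (A[X] ⧸ M) := by
    have := hg.finite_quotient
    have hle : Ideal.span {g} ≤ M := (Ideal.span_singleton_le_iff_mem M).2 (hOM hgO)
    have : Module.Finite A (A[X] ⧸ M) := Module.Finite.of_surjective
      (Ideal.Quotient.factorₐ A hle).toLinearMap (Ideal.Quotient.factor_surjective hle)
    infer_instance
  have hbot : (⊥ : Ideal (A[X] ⧸ M)).IsMaximal := by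
    let := Ideal.Quotient.field M
    exact Ideal.bot_isMaximal
  have hmax := Ideal.isMaximal_comap_of_isIntegral_of_isMaximal (R := A) (⊥ : Ideal (A[X] ⧸ M))
  have hC : ∀ a ∈ maximalIdeal A, Polynomial.C a ∈ M := by
    intro a ha
    rw [← eq_maximalIdeal hmax] at ha
    exact Ideal.Quotient.eq_zero_iff_mem.1 (show algebraMap A (A[X] ⧸ M) a = 0 by simpa using ha)
  refine hM.ne_top ((Ideal.eq_top_iff_one M).2 ?_)
  have h1 : u - 1 ∈ M := by
    rw [Polynomial.as_sum_support (u - 1)]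
    refine Ideal.sum_mem _ fun i _ => ?_
    rw [← Polynomial.C_mul_X_pow_eq_monomial]
    refine Ideal.mul_mem_right _ _ (hC _ ?_)
    rw [← residue_eq_zero_iff, ← Polynomial.coeff_map]
    simp [hu1]
  simpa using M.sub_mem (hOM hu) h1

/-- An ideal containing a monic polynomial whose reduction contains a polynomial of degree `s`
contains a monic polynomial of degree `s`. -/
theorem exists_monic_mem_of_map {I : Ideal A[X]} {f c : A[X]} (hf : f.Monic) (hfI : f ∈ I)
    (hc : c ∈ I) (hc0 : c.map (residue A) ≠ 0) :
    ∃ g ∈ I, g.Monic ∧ g.natDegree = (c.map (residue A)).natDegree := by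
  set s := (c.map (residue A)).natDegree with hs
  have := hf.finite_quotient
  let π : A[X] →ₗ[A] A[X] ⧸ Ideal.span {f} := (Ideal.Quotient.mkₐ A _).toLinearMap
  have hπ : Function.Surjective π := Ideal.Quotient.mk_surjective
  let N : Submodule A A[X] := degreeLT A s ⊔ I.restrictScalars A
  have hN : N.map π = ⊤ := by
    rw [eq_top_iff]
    refine Submodule.le_of_le_smul_of_le_jacobson_bot (I := maximalIdeal A) Module.Finite.fg_top
      (maximalIdeal_le_jacobson _) ?_
    rintro y -
    obtain ⟨b, rfl⟩ := hπ y
    obtain ⟨q, hq⟩ := Polynomial.map_surjective _ residue_surjective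
      (b.map (residue A) / c.map (residue A))
    obtain ⟨t, ht⟩ : ∃ t : A[X], t ∈ degreeLT A s ∧
        t.map (residue A) = b.map (residue A) % c.map (residue A) := by
      have hmem := Polynomial.degree_mod_lt (b.map (residue A)) hc0
      have hl : b.map (residue A) % c.map (residue A) ∈ lifts (residue A) :=
        (mem_lifts _).2 (Polynomial.map_surjective _ residue_surjective _)
      obtain ⟨t, ht, hdeg⟩ := exists_degree_eq_of_mem_lifts hl
      exact ⟨t, mem_degreeLT.2 (by rw [hdeg, hs, ← degree_eq_natDegree hc0]; exact hmem), ht⟩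
    have hd : (b - (t + c * q)).map (residue A) = 0 := by
      simp only [Polynomial.map_sub, Polynomial.map_add, Polynomial.map_mul, hq, ht.2]
      rw [add_comm, EuclideanDomain.div_add_mod, sub_self]
    have hd' : b - (t + c * q) ∈ maximalIdeal A • (⊤ : Submodule A A[X]) := by
      rw [Polynomial.as_sum_support (b - (t + c * q))]
      refine Submodule.sum_mem _ fun i _ => ?_
      rw [← Polynomial.C_mul_X_pow_eq_monomial, ← Polynomial.smul_eq_C_mul]
      refine Submodule.smul_mem_smul ?_ trivial
      rw [← residue_eq_zero_iff, ← Polynomial.coeff_map, hd, Polynomial.coeff_zero]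
    have hb : b = (t + c * q) + (b - (t + c * q)) := by ring
    rw [hb, map_add]
    refine Submodule.add_mem_sup (Submodule.mem_map_of_mem ?_) ?_
    · exact Submodule.add_mem_sup ht.1 (I.mul_mem_right _ hc)
    · have := Submodule.mem_map_of_mem (f := π) hd'
      rw [Submodule.map_smul''] at this
      exact Submodule.smul_mono le_rfl le_top this
  have hX : π (Polynomial.X ^ s) ∈ N.map π := hN ▸ trivial
  obtain ⟨n, hn, hnX⟩ := hX
  obtain ⟨t, ht, i, hi, rfl⟩ := Submodule.mem_sup.1 hn
  have hI : Polynomial.X ^ s - t ∈ I := by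
    have h1 : t + i - Polynomial.X ^ s ∈ Ideal.span {f} := Ideal.Quotient.eq.1 hnX
    have h2 := (Ideal.span_singleton_le_iff_mem I).2 hfI h1
    have : Polynomial.X ^ s - t = i - (t + i - Polynomial.X ^ s) := by ring
    rw [this]
    exact I.sub_mem hi h2
  have ht' := mem_degreeLT.1 ht
  exact ⟨Polynomial.X ^ s - t, hI, monic_X_pow_sub ht',
    natDegree_eq_of_degree_eq_some (by
      rw [degree_sub_eq_left_of_degree_lt (by rwa [degree_X_pow]), degree_X_pow])⟩


/-- The complement of a unimodular vector `p` in a module which becomes free of rank `r + 1` after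
inverting `f` becomes free of rank `r` after inverting `f` and one coordinate of `p`. -/
theorem exists_localized_basis_ker {B P : Type*} [CommRing B] [AddCommGroup P] [Module B P] {r : ℕ}
    {f : B} {φ : (Fin (r + 1) → B) →ₗ[B] P} {ψ : P →ₗ[B] (Fin (r + 1) → B)}
    (h : ∀ c, ψ (φ c) = f • c) (h' : ∀ p, φ (ψ p) = f • p) {p : P} {θ : P →ₗ[B] B}
    (hp : θ p = 1) :
    ∃ (φ' : (Fin r → B) →ₗ[B] LinearMap.ker θ) (ψ' : LinearMap.ker θ →ₗ[B] (Fin r → B)),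
      (∀ c, ψ' (φ' c) = (ψ p 0 * f) • c) ∧ ∀ z, φ' (ψ' z) = (ψ p 0 * f) • z := by
  let ι : (Fin r → B) →ₗ[B] (Fin (r + 1) → B) :=
    LinearMap.pi (Fin.cases 0 fun i => LinearMap.proj i)
  let π : P →ₗ[B] LinearMap.ker θ := LinearMap.codRestrict _
    (LinearMap.id - (LinearMap.toSpanSingleton B P p) ∘ₗ θ) (fun z => by simp [hp])
  let τ : P →ₗ[B] (Fin r → B) := LinearMap.pi fun i =>
    ψ p 0 • (LinearMap.proj i.succ ∘ₗ ψ) - ψ p i.succ • (LinearMap.proj 0 ∘ₗ ψ)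
  have hτ : ∀ z i, τ z i = ψ p 0 * ψ z i.succ - ψ p i.succ * ψ z 0 := fun z i => by simp [τ]
  refine ⟨π ∘ₗ φ ∘ₗ ι, τ ∘ₗ Submodule.subtype _, fun c => ?_, fun z => ?_⟩
  · ext i
    have e : ((π (φ (ι c)) : LinearMap.ker θ) : P) = φ (ι c) - θ (φ (ι c)) • p := by simp [π]
    simp only [LinearMap.comp_apply, Submodule.subtype_apply, e, hτ, map_sub, map_smul, h,
      Pi.sub_apply, Pi.smul_apply, smul_eq_mul]
    simp only [ι, LinearMap.pi_apply, Fin.cases_succ, Fin.cases_zero, LinearMap.proj_apply,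
      LinearMap.zero_apply]
    ring
  · have e : ι (τ z) = ψ p 0 • ψ z - ψ z 0 • ψ p := by
      ext i
      refine Fin.cases ?_ (fun i => ?_) i
      · simp [ι]; ring
      · simp [ι, hτ]; ring
    have hz : θ (z : P) = 0 := z.2
    ext
    simp only [LinearMap.comp_apply, Submodule.subtype_apply, e, map_sub, map_smul, h']
    simp [π, hp, hz, mul_smul]

theorem exists_unimodular_of_localized_basis [IsDomain A] {P : Type*} [AddCommGroup P]
    [Module A[X] P] [Module.Finite A[X] P] [Module.Projective A[X] P] {r : ℕ} {f : A[X]}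
    {φ : (Fin (r + 1) → A[X]) →ₗ[A[X]] P} {ψ : P →ₗ[A[X]] (Fin (r + 1) → A[X])} (hf : f.Monic)
    (h : ∀ c, ψ (φ c) = f • c) (h' : ∀ p, φ (ψ p) = f • p) :
    ∃ (p : P) (θ : P →ₗ[A[X]] A[X]), θ p = 1 ∧ (ψ p 0).Monic := by
  let : Algebra A[X] (ResidueField A)[X] := (Polynomial.mapRingHom (residue A)).toAlgebra
  have hal : ∀ b : A[X], algebraMap A[X] (ResidueField A)[X] b = b.map (residue A) := fun _ => rfl
  have hC : Function.Surjective (algebraMap A[X] (ResidueField A)[X]) :=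
    Polynomial.map_surjective _ residue_surjective
  have hf0 : algebraMap A[X] (ResidueField A)[X] f ≠ 0 := (hf.map _).ne_zero
  suffices H : ∃ (p : P) (θ : P →ₗ[A[X]] A[X]),
      (θ p).map (residue A) = 1 ∧ (ψ p 0).Monic by
    obtain ⟨p, θ, hθ, hm⟩ := H
    have htop := isLocalRing_eq_top_of_monic (O := LinearMap.range
      ((LinearMap.applyₗ p : (P →ₗ[A[X]] A[X]) →ₗ[A[X]] A[X]))) hm
      ⟨LinearMap.proj 0 ∘ₗ ψ, rfl⟩ ⟨θ, rfl⟩ hθ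
    obtain ⟨θ', hθ'⟩ := (Ideal.eq_top_iff_one _).1 htop
    exact ⟨p, θ', hθ', hm⟩
  rcases r with _ | r
  · obtain ⟨q, θ, hq, hq0, hmul⟩ := exists_reduction_of_eq_one hC hf0 h h'
    obtain ⟨g, ⟨p, rfl⟩, hg, hdeg⟩ := exists_monic_mem_of_map
      (I := LinearMap.range (LinearMap.proj 0 ∘ₗ ψ)) hf
      ⟨φ (fun _ => 1), by simp [h]⟩ ⟨q, rfl⟩ hq0
    have hp := hmul p
    have hg' : (ψ p 0).Monic := hg
    have hg0 := (hg'.map (residue A)).ne_zero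
    simp only [hal] at hp hq0
    have hdθ : ((θ p).map (residue A)).natDegree = 0 := by
      have h1 := congrArg natDegree hp
      rw [natDegree_mul (fun h0 => hg0 (by rw [hp, h0, zero_mul])) hq0, hg'.natDegree_map] at h1
      have h2 : (ψ p 0).natDegree = _ := hdeg
      simp only [LinearMap.comp_apply, LinearMap.proj_apply] at h2
      omega
    obtain ⟨a, ha⟩ := natDegree_eq_zero.1 hdθ
    have ha0 : a ≠ 0 := by
      rintro rfl
      exact hg0 (by rw [hp, ← ha]; simp)
    obtain ⟨b, hb⟩ := residue_surjective (a⁻¹)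
    refine ⟨p, Polynomial.C b • θ, ?_, hg'⟩
    rw [LinearMap.smul_apply, smul_eq_mul, Polynomial.map_mul, Polynomial.map_C, hb, ← ha,
      ← Polynomial.C_mul, inv_mul_cancel₀ ha0, Polynomial.C_1]
  · obtain ⟨q, θ, hx, hq⟩ := exists_reduction_of_two_le hC (by omega) hf0 h (φ (Pi.single 0 1))
    set n := (ψ q 0).natDegree + 1
    refine ⟨(Polynomial.X : A[X]) ^ n • φ (Pi.single 0 1) + q, θ, ?_, ?_⟩
    · rw [hal] at hx hq
      simp [hx, hq]
    · have e : ψ ((Polynomial.X : A[X]) ^ n • φ (Pi.single 0 1) + q) 0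
          = Polynomial.X ^ n * f + ψ q 0 := by
        simp [h]
      rw [e]
      refine ((monic_X_pow n).mul hf).add_of_left ?_
      refine degree_lt_degree ?_
      rw [(monic_X_pow n).natDegree_mul hf, natDegree_X_pow]
      omega

/-- A finite projective module over `A[X]`, with `A` a local domain, which becomes free after
inverting a monic polynomial is free. -/
theorem free_of_localized_basis [IsDomain A] (r : ℕ) : ∀ {P : Type*} [AddCommGroup P]
    [Module A[X] P] [Module.Finite A[X] P] [Module.Projective A[X] P] {f : A[X]}
    {φ : (Fin r → A[X]) →ₗ[A[X]] P} {ψ : P →ₗ[A[X]] (Fin r → A[X])}, f.Monic →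
    (∀ c, ψ (φ c) = f • c) → (∀ p, φ (ψ p) = f • p) → Module.Free A[X] P := by
  induction r with
  | zero =>
    intro P _ _ _ _ f φ ψ hf h h'
    have : Subsingleton P := subsingleton_of_forall_eq 0 fun p => by
      have h0 := h' p
      rw [Subsingleton.elim (ψ p) 0, map_zero] at h0
      exact (smul_eq_zero.1 h0.symm).resolve_left hf.ne_zero
    infer_instance
  | succ r ih =>
    intro P _ _ _ _ f φ ψ hf h h'
    obtain ⟨p, θ, hp, hm⟩ := exists_unimodular_of_localized_basis hf h h'
    obtain ⟨φ', ψ', h1, h2⟩ := exists_localized_basis_ker h h' hp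
    have hs : Function.Surjective θ := fun b => ⟨b • p, by simp [hp]⟩
    let e : P ≃ₗ[A[X]] LinearMap.ker θ × A[X] :=
      LinearEquiv.ofLinearMap
        (LinearMap.prod (LinearMap.codRestrict _
          (LinearMap.id - (LinearMap.toSpanSingleton A[X] P p) ∘ₗ θ) (fun z => by simp [hp])) θ)
        (LinearMap.coprod (Submodule.subtype _) (LinearMap.toSpanSingleton A[X] P p))
        (by ext z <;> simp [hp])
        (by ext z; simp)
    have : Module.Finite A[X] (LinearMap.ker θ) := Module.Finite.of_surjective
      (LinearMap.fst _ _ _ ∘ₗ e.toLinearMap) (Prod.fst_surjective.comp e.surjective)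
    have : Module.Projective A[X] (LinearMap.ker θ) := Module.Projective.of_split
      (Submodule.subtype _) (LinearMap.fst _ _ _ ∘ₗ e.toLinearMap)
      (by ext z; simp [e])
    have : Module.Free A[X] (LinearMap.ker θ) := ih (hm.mul hf) h1 h2
    exact Module.Free.of_equiv e.symm

end Horrocks

section Patching

variable {A : Type*} [CommRing A]

/-- An idempotent matrix splits if it factors through a free module. -/
def IsSplitIdempotent {N : ℕ} (e : Matrix (Fin N) (Fin N) A) : Prop :=
  ∃ (r : ℕ) (P : Matrix (Fin N) (Fin r) A) (Q : Matrix (Fin r) (Fin N) A), P * Q = e ∧ Q * P = 1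

/-- Every idempotent matrix over `A` splits, i.e. finite projective modules over `A` are free. -/
def IdempotentsSplit (A : Type*) [CommRing A] : Prop :=
  ∀ (N : ℕ) (e : Matrix (Fin N) (Fin N) A), e * e = e → IsSplitIdempotent e

theorem IsSplitIdempotent.map {B : Type*} [CommRing B] {N : ℕ} {e : Matrix (Fin N) (Fin N) A}
    (he : IsSplitIdempotent e) (f : A →+* B) : IsSplitIdempotent (e.map f) := by
  obtain ⟨r, P, Q, h1, h2⟩ := he
  exact ⟨r, P.map f, Q.map f, by rw [← Matrix.map_mul, h1], by
    rw [← Matrix.map_mul, h2, Matrix.map_one _ f.map_zero f.map_one]⟩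

theorem IdempotentsSplit.of_ringEquiv {B : Type*} [CommRing B] (h : IdempotentsSplit A)
    (f : A ≃+* B) : IdempotentsSplit B := by
  intro N e he
  have := (h N (e.map f.symm) (by rw [← Matrix.map_mul, he])).map f.toRingHom
  simpa [Matrix.map_map, Function.comp_def] using this

theorem isSplitIdempotent_of_free [Nontrivial A] {N : ℕ} {e : Matrix (Fin N) (Fin N) A}
    (he : e * e = e) [Module.Free A (LinearMap.range (Matrix.toLin' e))] : IsSplitIdempotent e := by
  set E := Matrix.toLin' e with hE
  have hEE : ∀ x, E (E x) = E x := fun x => by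
    rw [hE, ← Matrix.toLin'_mul_apply, he]
  let b := Module.finBasis A (LinearMap.range E)
  let P := LinearMap.toMatrix' ((LinearMap.range E).subtype ∘ₗ b.equivFun.symm.toLinearMap)
  let Q := LinearMap.toMatrix' (b.equivFun.toLinearMap ∘ₗ E.rangeRestrict)
  refine ⟨_, P, Q, ?_, ?_⟩
  · rw [← LinearMap.toMatrix'_comp, ← LinearMap.toMatrix'_toLin' e]
    congr 1
    ext x
    simp [hE]
  · rw [← LinearMap.toMatrix'_comp, ← LinearMap.toMatrix'_id]
    congr 1
    apply LinearMap.ext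
    intro x
    have : E.rangeRestrict (b.equivFun.symm x : LinearMap.range E) = b.equivFun.symm x := by
      obtain ⟨y, hy⟩ := (b.equivFun.symm x).2
      ext1
      change E (b.equivFun.symm x : LinearMap.range E) = _
      rw [← hy, hEE]
    simp only [LinearMap.comp_apply, Submodule.subtype_apply, LinearEquiv.coe_coe, this,
      LinearEquiv.apply_symm_apply, LinearMap.id_apply]

theorem idempotentsSplit_of_field (K : Type*) [Field K] : IdempotentsSplit K :=
  fun _ _ he => isSplitIdempotent_of_free he

open Polynomial

theorem exists_C_mul_mem_range {S : Type*} [CommRing S] (M : Submonoid A) (j : A →+* S)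
    (hj : ∀ s, ∃ a ∈ M, j a * s ∈ j.range) (q : S[X]) :
    ∃ a ∈ M, Polynomial.C (j a) * q ∈ (mapRingHom j).range := by
  induction q using Polynomial.induction_on' with
  | add p q hp hq =>
    obtain ⟨a, ha, ha'⟩ := hp
    obtain ⟨b, hb, hb'⟩ := hq
    refine ⟨a * b, M.mul_mem ha hb, ?_⟩
    have h1 : Polynomial.C (j (a * b)) * (p + q) =
        mapRingHom j (Polynomial.C b) * (Polynomial.C (j a) * p) +
        mapRingHom j (Polynomial.C a) * (Polynomial.C (j b) * q) := by
      simp; ring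
    rw [h1]
    exact add_mem (mul_mem ⟨_, rfl⟩ ha') (mul_mem ⟨_, rfl⟩ hb')
  | monomial n s =>
    obtain ⟨a, ha, b, hb⟩ := hj s
    exact ⟨a, ha, Polynomial.monomial n b, by simp [hb, Polynomial.C_mul_monomial]⟩

/-- Substitution `X ↦ X + a Y`. -/
noncomputable def shiftHom (a : A) : A[X] →+* A[X][X] :=
  eval₂RingHom (Polynomial.C.comp Polynomial.C)
    (Polynomial.C Polynomial.X + Polynomial.C (Polynomial.C a) * Polynomial.X)

/-- Substitution `Y ↦ a Y`. -/
noncomputable def scaleHom (a : A) : A[X][X] →+* A[X][X] :=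
  eval₂RingHom Polynomial.C (Polynomial.C (Polynomial.C a) * Polynomial.X)

theorem shiftHom_zero : shiftHom (0 : A) = Polynomial.C := by
  ext <;> simp [shiftHom]

theorem scaleHom_comp_shiftHom (a b : A) : (scaleHom b).comp (shiftHom a) = shiftHom (a * b) := by
  ext <;> simp [shiftHom, scaleHom, mul_assoc]

theorem scaleHom_comp_C (b : A) : (scaleHom b).comp Polynomial.C = Polynomial.C := by
  ext <;> simp [scaleHom]

theorem scaleHom_comp_scaleHom (a b : A) : (scaleHom b).comp (scaleHom a) = scaleHom (a * b) := by
  ext <;> simp [scaleHom, mul_assoc]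

theorem map_scaleHom {S : Type*} [CommRing S] (j : A →+* S) (a : A) :
    (mapRingHom (mapRingHom j)).comp (scaleHom a) =
      (scaleHom (j a)).comp (mapRingHom (mapRingHom j)) := by
  ext <;> simp [scaleHom]

theorem map_shiftHom {S : Type*} [CommRing S] (j : A →+* S) (a : A) :
    (mapRingHom (mapRingHom j)).comp (shiftHom a) =
      (shiftHom (j a)).comp (mapRingHom j) := by
  ext <;> simp [shiftHom]

/-- The scaling factors for which an idempotent is conjugate to its translates. -/
def conjIdeal {N : ℕ} (e : Matrix (Fin N) (Fin N) A[X]) : Ideal A where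
  carrier := {a | ∃ h h' : Matrix (Fin N) (Fin N) A[X][X], h * h' = 1 ∧
    h * e.map (shiftHom a) = e.map Polynomial.C * h}
  zero_mem' := ⟨1, 1, by simp, by simp [shiftHom_zero]⟩
  add_mem' := by
    rintro a b ⟨h, h', h1, h2⟩ ⟨k, k', k1, k2⟩
    let U : A[X][X] →+* A[X][X] := eval₂RingHom (shiftHom a) Polynomial.X
    have U1 : U.comp Polynomial.C = shiftHom a := by ext <;> simp [U]
    have U2 : U.comp (shiftHom b) = shiftHom (a + b) := by
      refine Polynomial.ringHom_ext (by simp [U, shiftHom]) ?_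
      simp [U, shiftHom]
      ring
    refine ⟨h * k.map U, k'.map U * h', ?_, ?_⟩
    · rw [Matrix.mul_assoc, ← Matrix.mul_assoc (k.map U), ← Matrix.map_mul, k1,
        Matrix.map_one _ U.map_zero U.map_one, Matrix.one_mul, h1]
    · have := congrArg (fun M => M.map U) k2
      simp only [Matrix.map_mul, Matrix.map_map, ← RingHom.coe_comp, U1, U2] at this
      rw [Matrix.mul_assoc, this, ← Matrix.mul_assoc, h2, Matrix.mul_assoc]
  smul_mem' := by
    rintro b a ⟨h, h', h1, h2⟩
    refine ⟨h.map (scaleHom b), h'.map (scaleHom b), ?_, ?_⟩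
    · rw [← Matrix.map_mul, h1, Matrix.map_one _ (scaleHom b).map_zero (scaleHom b).map_one]
    · have := congrArg (fun M => M.map (scaleHom b)) h2
      simp only [Matrix.map_mul, Matrix.map_map, ← RingHom.coe_comp, scaleHom_comp_shiftHom,
        scaleHom_comp_C] at this
      rw [smul_eq_mul, mul_comm, this]

theorem exists_lift_scaleHom {S : Type*} [CommRing S] (M : Submonoid A) (j : A →+* S)
    (hj : ∀ s, ∃ a ∈ M, j a * s ∈ j.range) (p : S[X][X])
    (hp : p.coeff 0 ∈ (mapRingHom j).range) :
    ∃ a ∈ M, scaleHom (j a) p ∈ (mapRingHom (mapRingHom j)).range := by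
  obtain ⟨c, ⟨a, ha, rfl⟩, ⟨q, hq⟩⟩ := exists_C_mul_mem_range (M.map (Polynomial.C : A →+* A[X]))
    (mapRingHom j) (fun s => by
      obtain ⟨a, ha, h⟩ := exists_C_mul_mem_range M j hj s
      exact ⟨_, ⟨a, ha, rfl⟩, by simpa using h⟩) p.divX
  obtain ⟨p0, hp0⟩ := hp
  refine ⟨a, ha, Polynomial.C p0 + Polynomial.X * scaleHom a q, ?_⟩
  have h1 := congrArg (fun f => f q) (map_scaleHom j a)
  simp only [RingHom.comp_apply] at h1
  rw [map_add, map_mul, h1, hq]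
  conv_rhs => rw [← p.divX_mul_X_add]
  rw [← hp0]
  simp [scaleHom]
  ring

theorem exists_lift_scaleHom_matrix {S : Type*} [CommRing S] (M : Submonoid A) (j : A →+* S)
    (hj : ∀ s, ∃ a ∈ M, j a * s ∈ j.range) {N : ℕ} (h : Matrix (Fin N) (Fin N) S[X][X])
    (hh : h.map (fun p => p.coeff 0) = 1) :
    ∃ a ∈ M, ∀ b, ∃ h' : Matrix (Fin N) (Fin N) A[X][X],
      h'.map (mapRingHom (mapRingHom j)) = h.map (scaleHom (j (a * b))) := by
  have key : ∀ i k, ∃ a ∈ M, scaleHom (j a) (h i k) ∈ (mapRingHom (mapRingHom j)).range := by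
    intro i k
    apply exists_lift_scaleHom M j hj
    have := congrFun (congrFun hh i) k
    simp only [Matrix.map_apply] at this
    rw [this, Matrix.one_apply]
    split_ifs
    exacts [one_mem _, zero_mem _]
  choose a ha ha' using key
  refine ⟨∏ i, ∏ k, a i k, prod_mem fun i _ => prod_mem fun k _ => ha i k, fun b => ?_⟩
  have : ∀ i k, ∃ p, mapRingHom (mapRingHom j) p =
      scaleHom (j ((∏ i, ∏ k, a i k) * b)) (h i k) := by
    intro i k
    obtain ⟨p, hp⟩ := ha' i k
    obtain ⟨c, hc⟩ : a i k ∣ (∏ i, ∏ k, a i k) * b :=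
      ((Finset.dvd_prod_of_mem _ (Finset.mem_univ k)).trans
        (Finset.dvd_prod_of_mem (fun i => ∏ k, a i k) (Finset.mem_univ i))).mul_right b
    refine ⟨scaleHom c p, ?_⟩
    have h1 := congrArg (fun f => f p) (map_scaleHom j c)
    simp only [RingHom.comp_apply] at h1
    rw [h1, hp, ← RingHom.comp_apply, scaleHom_comp_scaleHom, hc, map_mul]
  choose p hp using this
  exact ⟨Matrix.of p, by ext1 i k; simpa using hp i k⟩

theorem exists_mem_conjIdeal {S : Type*} [CommRing S] (M : Submonoid A) (j : A →+* S)
    (hinj : Function.Injective j) (hj : ∀ s, ∃ a ∈ M, j a * s ∈ j.range) {N : ℕ}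
    {e : Matrix (Fin N) (Fin N) A[X]} (he : e * e = e)
    (h1 : IsSplitIdempotent (e.map (mapRingHom j)))
    (h2 : IsSplitIdempotent (1 - e.map (mapRingHom j))) : ∃ a ∈ M, a ∈ conjIdeal e := by
  obtain ⟨r, P, Q, hPQ, hQP⟩ := h1
  obtain ⟨r', P', Q', hPQ', hQP'⟩ := h2
  set E := e.map (mapRingHom j) with hE
  have hEE : E * E = E := by rw [hE, ← Matrix.map_mul, he]
  have hQP0 : Q * P' = 0 := by
    calc Q * P' = (Q * P) * Q * P' * (Q' * P') := by rw [hQP, hQP']; simp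
      _ = Q * (P * Q) * (P' * Q') * P' := by simp only [Matrix.mul_assoc]
      _ = 0 := by
        rw [hPQ, hPQ', Matrix.mul_assoc Q, mul_sub, Matrix.mul_one, hEE]; simp
  have hQP0' : Q' * P = 0 := by
    calc Q' * P = (Q' * P') * Q' * P * (Q * P) := by rw [hQP, hQP']; simp
      _ = Q' * (P' * Q') * (P * Q) * P := by simp only [Matrix.mul_assoc]
      _ = 0 := by
        rw [hPQ, hPQ', Matrix.mul_assoc Q', sub_mul, Matrix.one_mul, hEE]; simp
  let s : S[X] →+* S[X][X] := shiftHom 1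
  let c : S[X] →+* S[X][X] := Polynomial.C
  let H := P.map c * Q.map s + P'.map c * Q'.map s
  let H' := P.map s * Q.map c + P'.map s * Q'.map c
  have z1 : ∀ f : S[X] →+* S[X][X], Q.map f * P.map f = 1 := fun f => by
    rw [← Matrix.map_mul, hQP, Matrix.map_one _ f.map_zero f.map_one]
  have z2 : ∀ f : S[X] →+* S[X][X], Q'.map f * P'.map f = 1 := fun f => by
    rw [← Matrix.map_mul, hQP', Matrix.map_one _ f.map_zero f.map_one]
  have z3 : ∀ f : S[X] →+* S[X][X], Q.map f * P'.map f = 0 := fun f => by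
    rw [← Matrix.map_mul, hQP0, Matrix.map_zero _ f.map_zero]
  have z4 : ∀ f : S[X] →+* S[X][X], Q'.map f * P.map f = 0 := fun f => by
    rw [← Matrix.map_mul, hQP0', Matrix.map_zero _ f.map_zero]
  have z5 : ∀ f : S[X] →+* S[X][X], E.map f = P.map f * Q.map f := fun f => by
    rw [← Matrix.map_mul, hPQ]
  have z6 : ∀ f : S[X] →+* S[X][X], P.map f * Q.map f + P'.map f * Q'.map f = 1 := fun f => by
    rw [← Matrix.map_mul, ← Matrix.map_mul, hPQ, hPQ', ← Matrix.map_add _ f.map_add]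
    simp [Matrix.map_one _ f.map_zero f.map_one]
  have hHH : H * H' = 1 := by
    have : H * H' = P.map c * (Q.map s * P.map s) * Q.map c
        + P.map c * (Q.map s * P'.map s) * Q'.map c
        + P'.map c * (Q'.map s * P.map s) * Q.map c
        + P'.map c * (Q'.map s * P'.map s) * Q'.map c := by
      simp only [H, H', mul_add, add_mul, Matrix.mul_assoc]
      abel
    rw [this, z1, z2, z3, z4]
    simpa using z6 c
  have hHE : H * E.map s = E.map c * H := by
    have e1 : H * E.map s = P.map c * (Q.map s * P.map s) * Q.map s
        + P'.map c * (Q'.map s * P.map s) * Q.map s := by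
      simp only [H, z5, Matrix.mul_assoc, Matrix.add_mul]
    have e2 : E.map c * H = P.map c * (Q.map c * P.map c) * Q.map s
        + P.map c * (Q.map c * P'.map c) * Q'.map s := by
      simp only [H, z5, Matrix.mul_assoc, Matrix.mul_add]
    rw [e1, e2, z1, z1, z3, z4]
    simp
  have hev : ∀ f : S[X] →+* S[X][X], (∀ a, (f a).coeff 0 = a) → ∀ g : S[X] →+* S[X][X],
      (∀ a, (g a).coeff 0 = a) → (P.map f * Q.map g + P'.map f * Q'.map g).map
        (fun p => p.coeff 0) = 1 := by
    intro f hf g hg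
    have e1 : (fun p : S[X][X] => p.coeff 0) = Polynomial.constantCoeff := rfl
    rw [e1, Matrix.map_add _ (map_add _), Matrix.map_mul, Matrix.map_mul]
    simp only [Matrix.map_map]
    have e2 : (Polynomial.constantCoeff : S[X][X] →+* S[X]) ∘ f = id := funext hf
    have e3 : (Polynomial.constantCoeff : S[X][X] →+* S[X]) ∘ g = id := funext hg
    simp [e2, e3, hPQ, hPQ']
  have hs0 : ∀ a, (s a).coeff 0 = a := by
    intro a
    have : (Polynomial.constantCoeff : S[X][X] →+* S[X]).comp s = RingHom.id _ := by
      ext <;> simp [s, shiftHom]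
    exact congrArg (fun f => f a) this
  have hc0 : ∀ a, (c a).coeff 0 = a := fun a => Polynomial.coeff_C_zero
  obtain ⟨a, ha, hla⟩ := exists_lift_scaleHom_matrix M j hj H (hev c hc0 s hs0)
  obtain ⟨b, hb, hlb⟩ := exists_lift_scaleHom_matrix M j hj H' (hev s hs0 c hc0)
  obtain ⟨h, hh⟩ := hla b
  obtain ⟨h', hh'⟩ := hlb a
  rw [mul_comm b a] at hh'
  refine ⟨a * b, M.mul_mem ha hb, h, h', ?_, ?_⟩
  · apply Matrix.map_injective (f := mapRingHom (mapRingHom j))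
      (Polynomial.map_injective _ (Polynomial.map_injective j hinj))
    change (h * h').map (mapRingHom (mapRingHom j)) =
      Matrix.map 1 (mapRingHom (mapRingHom j))
    rw [Matrix.map_mul, hh, hh', ← Matrix.map_mul, hHH]
    rw [Matrix.map_one _ (map_zero _) (map_one _), Matrix.map_one _ (map_zero _) (map_one _)]
  · apply Matrix.map_injective (f := mapRingHom (mapRingHom j))
      (Polynomial.map_injective _ (Polynomial.map_injective j hinj))
    change (h * e.map (shiftHom (a * b))).map (mapRingHom (mapRingHom j)) =
      (e.map Polynomial.C * h).map (mapRingHom (mapRingHom j))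
    have e1 := congrArg (fun M => M.map (scaleHom (j (a * b)))) hHE
    simp only [Matrix.map_mul, hE, Matrix.map_map, ← RingHom.coe_comp, s, c,
      ← RingHom.comp_assoc, scaleHom_comp_shiftHom, scaleHom_comp_C, one_mul] at e1
    rw [Matrix.map_mul, Matrix.map_mul, hh, Matrix.map_map, Matrix.map_map, ← RingHom.coe_comp,
      map_shiftHom, e1]
    congr 2
    ext1 x
    simp

theorem isSplitIdempotent_polynomial_of_local [IsDomain A] {N : ℕ}
    {e : Matrix (Fin N) (Fin N) A[X]} (he : e * e = e)
    (h : ∀ (m : Ideal A) [m.IsMaximal],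
      IsSplitIdempotent (e.map (mapRingHom (algebraMap A (Localization.AtPrime m)))) ∧
      IsSplitIdempotent (1 - e.map (mapRingHom (algebraMap A (Localization.AtPrime m)))))
    (h0 : IsSplitIdempotent (e.map (Polynomial.evalRingHom (0 : A)))) : IsSplitIdempotent e := by
  have htop : conjIdeal e = ⊤ := by
    by_contra hne
    obtain ⟨m, hm, hle⟩ := Ideal.exists_le_maximal _ hne
    obtain ⟨a, ha, ha'⟩ := exists_mem_conjIdeal m.primeCompl
      (algebraMap A (Localization.AtPrime m))
      (IsLocalization.injective _ m.primeCompl_le_nonZeroDivisors) (fun s => by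
        obtain ⟨⟨x, y⟩, hxy⟩ := IsLocalization.surj m.primeCompl s
        exact ⟨y, y.2, x, by rw [← hxy, mul_comm]⟩) he (h m).1 (h m).2
    exact ha (hle ha')
  obtain ⟨k, k', hk, hke⟩ : (1 : A) ∈ conjIdeal e := htop ▸ Submodule.mem_top
  let V : A[X][X] →+* A[X] :=
    eval₂RingHom (Polynomial.C.comp (Polynomial.evalRingHom 0)) Polynomial.X
  have V1 : V.comp Polynomial.C = Polynomial.C.comp (Polynomial.evalRingHom 0) := by
    ext <;> simp [V]
  have V2 : V.comp (shiftHom 1) = RingHom.id _ := by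
    ext <;> simp [V, shiftHom]
  have hk' := congrArg (fun M => M.map V) hke
  have hkk := congrArg (fun M => M.map V) hk
  simp only [Matrix.map_mul, Matrix.map_map, ← RingHom.coe_comp, V1, V2,
    Matrix.map_one _ V.map_zero V.map_one] at hk' hkk
  have hkk' := mul_eq_one_comm.1 hkk
  obtain ⟨r, P, Q, hPQ, hQP⟩ := h0.map (Polynomial.C : A →+* A[X])
  refine ⟨r, k'.map V * P, Q * k.map V, ?_, ?_⟩
  · rw [Matrix.mul_assoc, ← Matrix.mul_assoc P, hPQ, Matrix.map_map, ← RingHom.coe_comp, ← hk',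
      ← Matrix.mul_assoc, hkk']
    simp
  · rw [Matrix.mul_assoc, ← Matrix.mul_assoc (k.map V), hkk, Matrix.one_mul, hQP]

end Patching

section QuillenSuslin

open Polynomial

theorem isSplitIdempotent_of_isLocalRing {A : Type*} [CommRing A] [IsLocalRing A] [IsDomain A]
    {N r : ℕ} {e : Matrix (Fin N) (Fin N) A[X]} (he : e * e = e) {f : A[X]} (hf : f.Monic)
    {P : Matrix (Fin N) (Fin r) A[X]} {Q : Matrix (Fin r) (Fin N) A[X]} (heP : e * P = P)
    (hPQ : P * Q = f • e) (hQP : Q * P = f • (1 : Matrix (Fin r) (Fin r) A[X])) :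
    IsSplitIdempotent e := by
  set E := Matrix.toLin' e with hE
  have hEE : ∀ x, E (E x) = E x := fun x => by rw [hE, ← Matrix.toLin'_mul_apply, he]
  have hEr : ∀ x : LinearMap.range E, E x = x := by
    rintro ⟨_, y, rfl⟩
    exact hEE y
  have : Module.Finite A[X] (LinearMap.range E) := inferInstance
  have : Module.Projective A[X] (LinearMap.range E) :=
    Module.Projective.of_split (LinearMap.range E).subtype E.rangeRestrict
      (by
        apply LinearMap.ext
        intro x
        ext1
        exact hEr x)
  let φ : (Fin r → A[X]) →ₗ[A[X]] LinearMap.range E :=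
    LinearMap.codRestrict _ (Matrix.toLin' P) (fun c => ⟨Matrix.toLin' P c, by
      rw [hE, ← Matrix.toLin'_mul_apply, heP]⟩)
  have : Module.Free A[X] (LinearMap.range E) := by
    refine free_of_localized_basis r (φ := φ)
      (ψ := Matrix.toLin' Q ∘ₗ (LinearMap.range E).subtype) hf ?_ ?_
    · intro c
      change Matrix.toLin' Q (Matrix.toLin' P c) = _
      rw [← Matrix.toLin'_mul_apply, hQP]
      simp
    · intro p
      ext1
      change Matrix.toLin' P (Matrix.toLin' Q p) = _
      rw [← Matrix.toLin'_mul_apply, hPQ, map_smul, LinearMap.smul_apply, ← hE, hEr]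
      rfl
  exact isSplitIdempotent_of_free he

theorem exists_monic_map_eq_smul {A : Type*} [CommRing A] {E : Type*} [CommRing E] (j : A[X] →+* E)
    (hj : ∀ s, ∃ f : A[X], f.Monic ∧ j f * s ∈ j.range) {a b : ℕ} (P : Matrix (Fin a) (Fin b) E) :
    ∃ f : A[X], f.Monic ∧ ∃ P' : Matrix (Fin a) (Fin b) A[X], P'.map j = j f • P := by
  choose f hf hfj using fun i k => hj (P i k)
  refine ⟨∏ i, ∏ k, f i k,
    Polynomial.monic_prod_of_monic _ _ fun i _ =>
      Polynomial.monic_prod_of_monic _ _ fun k _ => hf i k, ?_⟩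
  have : ∀ i k, ∃ p, j p = j (∏ i, ∏ k, f i k) * P i k := by
    intro i k
    obtain ⟨p, hp⟩ := hfj i k
    obtain ⟨c, hc⟩ : f i k ∣ ∏ i, ∏ k, f i k :=
      (Finset.dvd_prod_of_mem _ (Finset.mem_univ k)).trans
        (Finset.dvd_prod_of_mem (fun i => ∏ k, f i k) (Finset.mem_univ i))
    refine ⟨c * p, ?_⟩
    rw [hc, map_mul, map_mul, hp]
    ring
  choose p hp using this
  exact ⟨Matrix.of p, by ext1 i k; simpa using hp i k⟩

theorem isSplitIdempotent_map_of_localization {A : Type*} [CommRing A] [IsDomain A] {E : Type*}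
    [CommRing E] (j : A[X] →+* E) (hinj : Function.Injective j)
    (hj : ∀ s, ∃ f : A[X], f.Monic ∧ j f * s ∈ j.range) (hE : IdempotentsSplit E) {N : ℕ}
    {e : Matrix (Fin N) (Fin N) A[X]} (he : e * e = e) {B : Type*} [CommRing B] [IsLocalRing B]
    [IsDomain B] (i : A →+* B) : IsSplitIdempotent (e.map (mapRingHom i)) := by
  have he' : e.map j * e.map j = e.map j := by rw [← Matrix.map_mul, he]
  obtain ⟨r, P, Q, hPQ, hQP⟩ := hE N (e.map j) he'
  obtain ⟨f, hf, P', hP⟩ := exists_monic_map_eq_smul j hj P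
  obtain ⟨g, hg, Q', hQ⟩ := exists_monic_map_eq_smul j hj Q
  have hinj' : ∀ {a b : ℕ}, Function.Injective
      (fun M : Matrix (Fin a) (Fin b) A[X] => M.map j) :=
    fun {_ _} => Matrix.map_injective hinj
  have h1 : e * P' = P' := by
    apply hinj'
    simp only [Matrix.map_mul, hP]
    rw [← hPQ, Matrix.mul_smul, Matrix.mul_assoc, hQP, Matrix.mul_one]
  have h2 : P' * Q' = (f * g) • e := by
    apply hinj'
    simp only [Matrix.map_mul, hP, hQ]
    rw [Matrix.smul_mul, Matrix.mul_smul, hPQ, smul_smul]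
    ext
    simp
  have h3 : Q' * P' = (f * g) • (1 : Matrix (Fin r) (Fin r) A[X]) := by
    apply hinj'
    simp only [Matrix.map_mul, hP, hQ]
    rw [Matrix.smul_mul, Matrix.mul_smul, hQP, smul_smul]
    ext
    simp [Matrix.one_apply, apply_ite j, mul_comm]
  have hsm : ∀ {n : ℕ} (a : A[X]) (M : Matrix (Fin n) (Fin n) A[X]),
      (a • M).map (mapRingHom i) = mapRingHom i a • M.map (mapRingHom i) := by
    intros
    ext1
    simp
  refine isSplitIdempotent_of_isLocalRing (f := (f * g).map i) (P := P'.map (mapRingHom i))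
    (Q := Q'.map (mapRingHom i)) (by rw [← Matrix.map_mul, he]) ((hf.mul hg).map i)
    (by rw [← Matrix.map_mul, h1]) ?_ ?_
  · rw [← Matrix.map_mul, h2, hsm, coe_mapRingHom]
  · rw [← Matrix.map_mul, h3, hsm, Matrix.map_one _ (map_zero _) (map_one _), coe_mapRingHom]

theorem idempotentsSplit_polynomial {A : Type*} [CommRing A] [IsDomain A] {E : Type*}
    [CommRing E] (j : A[X] →+* E) (hinj : Function.Injective j)
    (hj : ∀ s, ∃ f : A[X], f.Monic ∧ j f * s ∈ j.range) (hE : IdempotentsSplit E)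
    (hA : IdempotentsSplit A) : IdempotentsSplit A[X] := by
  intro N e he
  refine isSplitIdempotent_polynomial_of_local he (fun m _ => ⟨?_, ?_⟩)
    (hA N _ (by rw [← Matrix.map_mul, he]))
  · exact isSplitIdempotent_map_of_localization j hinj hj hE he _
  · have := isSplitIdempotent_map_of_localization j hinj hj hE
      (e := 1 - e) (by rw [mul_sub, sub_mul, sub_mul, he]; simp)
      (algebraMap A (Localization.AtPrime m))
    rwa [Matrix.map_sub _ (map_sub _), Matrix.map_one _ (map_zero _) (map_one _)] at this

theorem exists_monic_mul_mem_range (K : Type*) [Field K] (σ : Type*) :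
    ∃ j : (MvPolynomial σ K)[X] →+* MvPolynomial σ (FractionRing K[X]), Function.Injective j ∧
      ∀ s, ∃ f : (MvPolynomial σ K)[X], f.Monic ∧ j f * s ∈ j.range := by
  let k : (MvPolynomial σ K)[X] ≃+* MvPolynomial σ K[X] :=
    ((MvPolynomial.optionEquivLeft K σ).symm.trans
      (MvPolynomial.optionEquivRight K σ)).toRingEquiv
  let t : MvPolynomial σ K[X] →+* MvPolynomial σ (FractionRing K[X]) :=
    MvPolynomial.map (algebraMap K[X] (FractionRing K[X]))
  have ht : Function.Injective t :=
    MvPolynomial.map_injective _ (IsFractionRing.injective K[X] (FractionRing K[X]))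
  refine ⟨t.comp k.toRingHom, ht.comp k.injective, fun s => ?_⟩
  have hk : ∀ g : K[X], k (g.map MvPolynomial.C) = MvPolynomial.C g := by
    intro g
    have : (k.toRingHom.comp (mapRingHom MvPolynomial.C)) = MvPolynomial.C := by
      refine Polynomial.ringHom_ext (fun a => ?_) ?_
      · simp [k]
      · simp [k]
    exact congrArg (fun f => f g) this
  obtain ⟨g, hg, hgs⟩ : ∃ g : K[X], g ≠ 0 ∧ t (MvPolynomial.C g) * s ∈ t.range := by
    induction s using MvPolynomial.induction_on' with
    | monomial u a =>
      obtain ⟨⟨x, y⟩, hxy⟩ := IsLocalization.surj (nonZeroDivisors K[X]) a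
      refine ⟨y, nonZeroDivisors.coe_ne_zero y, MvPolynomial.monomial u x, ?_⟩
      simp only [t, MvPolynomial.map_monomial, MvPolynomial.map_C, MvPolynomial.C_mul_monomial]
      rw [← hxy, mul_comm]
    | add p q hp hq =>
      obtain ⟨a, ha, ha'⟩ := hp
      obtain ⟨b, hb, hb'⟩ := hq
      refine ⟨a * b, mul_ne_zero ha hb, ?_⟩
      have h1 : t (MvPolynomial.C (a * b)) * (p + q) =
          t (MvPolynomial.C b) * (t (MvPolynomial.C a) * p) +
          t (MvPolynomial.C a) * (t (MvPolynomial.C b) * q) := by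
        rw [map_mul, map_mul]; ring
      rw [h1]
      exact add_mem (mul_mem ⟨_, rfl⟩ ha') (mul_mem ⟨_, rfl⟩ hb')
  refine ⟨(g * Polynomial.C g.leadingCoeff⁻¹).map MvPolynomial.C,
    (monic_mul_leadingCoeff_inv hg).map _, ?_⟩
  obtain ⟨p, hp⟩ := hgs
  refine ⟨k.symm (MvPolynomial.C (Polynomial.C g.leadingCoeff⁻¹) * p), ?_⟩
  simp only [RingHom.comp_apply, RingEquiv.toRingHom_eq_coe, RingEquiv.coe_toRingHom,
    RingEquiv.apply_symm_apply, hk]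
  rw [map_mul, map_mul, hp, map_mul]
  ring

/-- The Quillen–Suslin theorem. -/
theorem idempotentsSplit_mvPolynomial (σ : Type*) [Finite σ] :
    ∀ (K : Type*) [Field K], IdempotentsSplit (MvPolynomial σ K) := by
  induction σ using Finite.induction_empty_option with
  | of_equiv e h =>
    intro K _
    exact (h K).of_ringEquiv (MvPolynomial.renameEquiv K e).toRingEquiv
  | h_empty =>
    intro K _
    exact (idempotentsSplit_of_field K).of_ringEquiv
      (MvPolynomial.isEmptyRingEquiv K PEmpty).symm
  | h_option h =>
    rename_i τ _
    intro K _
    obtain ⟨j, hinj, hj⟩ := exists_monic_mul_mem_range K τ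
    exact (idempotentsSplit_polynomial j hinj hj (h _) (h K)).of_ringEquiv
      (MvPolynomial.optionEquivLeft K τ).symm.toRingEquiv

end QuillenSuslin

section MinorIdeal

variable {R : Type*} [CommRing R]

/-- The ideal generated by the `k × k` minors. -/
def minorIdeal {l m : ℕ} (k : ℕ) (F : Matrix (Fin l) (Fin m) R) : Ideal R :=
  Ideal.span (Set.range fun s : (Fin k → Fin l) × (Fin k → Fin m) => (F.submatrix s.1 s.2).det)

variable {l m k : ℕ}

theorem det_submatrix_mem_minorIdeal (F : Matrix (Fin l) (Fin m) R) (ri : Fin k → Fin l)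
    (ci : Fin k → Fin m) : (F.submatrix ri ci).det ∈ minorIdeal k F :=
  Ideal.subset_span ⟨(ri, ci), rfl⟩

theorem minorIdeal_le {F : Matrix (Fin l) (Fin m) R} {I : Ideal R}
    (h : ∀ (ri : Fin k → Fin l) (ci : Fin k → Fin m), (F.submatrix ri ci).det ∈ I) :
    minorIdeal k F ≤ I := by
  refine Ideal.span_le.2 ?_
  rintro _ ⟨s, rfl⟩
  exact h _ _

theorem minorIdeal_le_of_injective {F : Matrix (Fin l) (Fin m) R} {I : Ideal R}
    (h : ∀ (ri : Fin k → Fin l) (ci : Fin k → Fin m), Function.Injective ri →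
      Function.Injective ci → (F.submatrix ri ci).det ∈ I) : minorIdeal k F ≤ I := by
  refine minorIdeal_le fun ri ci => ?_
  by_cases hr : Function.Injective ri
  · by_cases hc : Function.Injective ci
    · exact h ri ci hr hc
    · simp only [Function.Injective, not_forall] at hc
      obtain ⟨a, b, hab, hne⟩ := hc
      rw [Matrix.det_zero_of_column_eq hne (by simp [hab])]
      exact I.zero_mem
  · simp only [Function.Injective, not_forall] at hr
    obtain ⟨a, b, hab, hne⟩ := hr
    rw [Matrix.det_zero_of_row_eq hne (by ext; simp [hab])]
    exact I.zero_mem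

theorem minorIdeal_transpose_le (F : Matrix (Fin l) (Fin m) R) :
    minorIdeal k Fᵀ ≤ minorIdeal k F := by
  refine minorIdeal_le fun ri ci => ?_
  rw [← Matrix.transpose_submatrix, Matrix.det_transpose]
  exact det_submatrix_mem_minorIdeal _ _ _

theorem minorIdeal_transpose (F : Matrix (Fin l) (Fin m) R) :
    minorIdeal k Fᵀ = minorIdeal k F :=
  le_antisymm (minorIdeal_transpose_le F) (minorIdeal_transpose_le Fᵀ)

theorem minorIdeal_mul_le_right {n : ℕ} (M : Matrix (Fin n) (Fin l) R)
    (F : Matrix (Fin l) (Fin m) R) : minorIdeal k (M * F) ≤ minorIdeal k F := by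
  refine minorIdeal_le fun ri ci => ?_
  have h : (M * F).submatrix ri ci =
      fun i => ∑ a, M (ri i) a • (fun j => F a (ci j) : Fin k → R) := by
    ext i j
    simp [Matrix.mul_apply]
  have h2 := (Matrix.detRowAlternating (R := R) (n := Fin k)).toMultilinearMap.map_sum
    (fun i a => M (ri i) a • (fun j => F a (ci j) : Fin k → R))
  change (Matrix.detRowAlternating (R := R) (n := Fin k)).toMultilinearMap _ ∈ _
  rw [h, h2]
  refine sum_mem fun s _ => ?_
  rw [MultilinearMap.map_smul_univ]
  exact Ideal.mul_mem_left _ _ (det_submatrix_mem_minorIdeal F s ci)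

theorem minorIdeal_mul_le_left {n : ℕ} (F : Matrix (Fin l) (Fin m) R)
    (M : Matrix (Fin m) (Fin n) R) : minorIdeal k (F * M) ≤ minorIdeal k F := by
  rw [← minorIdeal_transpose, Matrix.transpose_mul, ← minorIdeal_transpose F]
  exact minorIdeal_mul_le_right _ _

theorem minorIdeal_succ_le (F : Matrix (Fin l) (Fin m) R) :
    minorIdeal (k + 1) F ≤ minorIdeal k F := by
  refine minorIdeal_le fun ri ci => ?_
  rw [Matrix.det_succ_row_zero]
  refine sum_mem fun j _ => Ideal.mul_mem_left _ _ ?_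
  rw [Matrix.submatrix_submatrix]
  exact det_submatrix_mem_minorIdeal _ _ _

theorem minorIdeal_map {S : Type*} [CommRing S] (f : R →+* S) (F : Matrix (Fin l) (Fin m) R) :
    minorIdeal k (F.map f) = (minorIdeal k F).map f := by
  rw [minorIdeal, minorIdeal, Ideal.map_span, ← Set.range_comp]
  congr 2
  ext s
  simp only [Function.comp_apply, RingHom.map_det]
  rfl

theorem minorIdeal_smul (c : R) (F : Matrix (Fin l) (Fin m) R) :
    minorIdeal k (c • F) = Ideal.span {c ^ k} * minorIdeal k F := by
  rw [minorIdeal, minorIdeal, Ideal.span_mul_span', Set.singleton_mul, ← Set.range_comp]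
  congr 2
  ext s
  simp only [Function.comp_apply]
  change (c • F.submatrix s.1 s.2).det = _
  simp

theorem minorIdeal_zero (F : Matrix (Fin l) (Fin m) R) : minorIdeal 0 F = ⊤ := by
  rw [Ideal.eq_top_iff_one]
  simpa using det_submatrix_mem_minorIdeal F (k := 0) Fin.elim0 Fin.elim0

theorem apply_mem_minorIdeal_one (F : Matrix (Fin l) (Fin m) R) (i : Fin l) (j : Fin m) :
    F i j ∈ minorIdeal 1 F := by
  simpa using det_submatrix_mem_minorIdeal F (k := 1) (fun _ => i) (fun _ => j)

theorem minorIdeal_eq_bot_of_lt {F : Matrix (Fin l) (Fin m) R} (h : l < k ∨ m < k) :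
    minorIdeal k F = ⊥ := by
  refine le_bot_iff.1 (minorIdeal_le_of_injective fun ri ci hr hc => ?_)
  have h1 := Fintype.card_le_of_injective _ hr
  have h2 := Fintype.card_le_of_injective _ hc
  simp only [Fintype.card_fin] at h1 h2
  omega

theorem minorIdeal_one_eq_top (h : k ≤ l) :
    minorIdeal k (1 : Matrix (Fin l) (Fin l) R) = ⊤ := by
  rw [Ideal.eq_top_iff_one]
  have := det_submatrix_mem_minorIdeal (1 : Matrix (Fin l) (Fin l) R) (Fin.castLE h) (Fin.castLE h)
  rwa [Matrix.submatrix_one _ (Fin.castLE_injective h), Matrix.det_one] at this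

theorem minorIdeal_self_le (F : Matrix (Fin k) (Fin k) R) :
    minorIdeal k F ≤ Ideal.span {F.det} := by
  refine minorIdeal_le_of_injective fun ri ci hr hc => ?_
  let e := Equiv.ofBijective ri (Finite.injective_iff_bijective.1 hr)
  let e' := Equiv.ofBijective ci (Finite.injective_iff_bijective.1 hc)
  have : F.submatrix ri ci = (F.submatrix e e).submatrix id (e'.trans e.symm) := by
    ext i j
    change F (ri i) (ci j) = F (e i) (e (e.symm (ci j)))
    rw [Equiv.apply_symm_apply]
    rfl
  rw [this, Matrix.det_permute', Matrix.det_submatrix_equiv_self]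
  exact Ideal.mul_mem_left _ _ (Ideal.mem_span_singleton_self _)

theorem det_submatrix_mul_apply_eq [IsDomain R] {F : Matrix (Fin l) (Fin m) R}
    (hF : minorIdeal (k + 1) F = ⊥) {ri : Fin k → Fin l} {ci : Fin k → Fin m}
    (h : (F.submatrix ri ci).det ≠ 0) :
    F.submatrix id ci * (F.submatrix ri ci).adjugate * F.submatrix ri id =
      (F.submatrix ri ci).det • F := by
  ext i j
  set A := F.submatrix ri ci with hA
  let b : Matrix (Fin k) (Fin 1) R := F.submatrix ri (fun _ => j)
  let c : Matrix (Fin 1) (Fin k) R := F.submatrix (fun _ => i) ci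
  let d : Matrix (Fin 1) (Fin 1) R := Matrix.of fun _ _ => F i j
  have h0 : (Matrix.fromBlocks A b c d).det = 0 := by
    have h1 := det_submatrix_mem_minorIdeal F (Fin.snoc ri i : Fin (k + 1) → Fin l)
      (Fin.snoc ci j : Fin (k + 1) → Fin m)
    rw [hF, Ideal.mem_bot] at h1
    rw [← h1, ← Matrix.det_submatrix_equiv_self finSumFinEquiv]
    congr 1
    ext x y
    rcases x with x | x <;> rcases y with y | y <;>
      simp [A, b, c, d, Fin.snoc, finSumFinEquiv, Fin.castLT, Fin.castAdd]
  have h2 : Matrix.fromBlocks A b c d *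
      Matrix.fromBlocks (1 : Matrix (Fin k) (Fin k) R) (-(A.adjugate * b)) 0
        (A.det • (1 : Matrix (Fin 1) (Fin 1) R)) =
      Matrix.fromBlocks A 0 c (A.det • d - c * A.adjugate * b) := by
    rw [Matrix.fromBlocks_multiply]
    congr 1
    · simp
    · rw [Matrix.mul_neg, ← Matrix.mul_assoc, Matrix.mul_adjugate]
      simp
    · simp
    · rw [Matrix.mul_neg, ← Matrix.mul_assoc]
      simp [sub_eq_add_neg, add_comm]
  have h3 := congrArg Matrix.det h2
  rw [Matrix.det_mul, h0, zero_mul, Matrix.det_fromBlocks_zero₁₂, Matrix.det_fin_one] at h3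
  have h4 := (mul_eq_zero.1 h3.symm).resolve_left h
  rw [Matrix.sub_apply, sub_eq_zero] at h4
  exact h4.symm

theorem adjugate_mul_submatrix_mem (F : Matrix (Fin l) (Fin m) R) (ri : Fin k → Fin l)
    (ci : Fin k → Fin m) (a : Fin k) (j : Fin m) :
    ((F.submatrix ri ci).adjugate * F.submatrix ri id) a j ∈ minorIdeal k F := by
  have h : ((F.submatrix ri ci).adjugate * F.submatrix ri id) a j =
      ((F.submatrix ri ci).updateCol a (fun b => F (ri b) j)).det := by
    rw [← Matrix.cramer_apply, Matrix.cramer_eq_adjugate_mulVec]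
    rfl
  have h2 : (F.submatrix ri ci).updateCol a (fun b => F (ri b) j) =
      F.submatrix ri (Function.update ci a j) := by
    ext x y
    by_cases hy : y = a
    · subst hy; simp
    · simp [hy]
  rw [h, h2]
  exact det_submatrix_mem_minorIdeal _ _ _

theorem submatrix_mul_adjugate_mem (F : Matrix (Fin l) (Fin m) R) (ri : Fin k → Fin l)
    (ci : Fin k → Fin m) (i : Fin l) (b : Fin k) :
    (F.submatrix id ci * (F.submatrix ri ci).adjugate) i b ∈ minorIdeal k F := by
  have := adjugate_mul_submatrix_mem Fᵀ ci ri b i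
  rw [minorIdeal_transpose] at this
  rwa [← Matrix.transpose_submatrix, ← Matrix.transpose_submatrix, ← Matrix.adjugate_transpose,
    ← Matrix.transpose_mul, Matrix.transpose_apply] at this

/-- A generalized inverse up to the factor `d`. -/
theorem exists_mul_mul_eq_smul [IsDomain R] {F : Matrix (Fin l) (Fin m) R} {d : R}
    (hd : minorIdeal k F = Ideal.span {d}) (hF : minorIdeal (k + 1) F = ⊥) :
    ∃ W : Matrix (Fin m) (Fin l) R, F * W * F = d • F ∧ (∀ i j, d ∣ (W * F) i j) ∧
      ∀ i j, d ∣ (F * W) i j := by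
  classical
  have hdm : d ∈ minorIdeal k F := hd ▸ Ideal.mem_span_singleton_self d
  obtain ⟨c, hc⟩ := Ideal.mem_span_range_iff_exists_fun.1 hdm
  let D : (Fin k → Fin l) × (Fin k → Fin m) → R := fun s => (F.submatrix s.1 s.2).det
  let c' : (Fin k → Fin l) × (Fin k → Fin m) → R := fun s => if D s = 0 then 0 else c s
  have hc' : ∑ s, c' s * D s = d := by
    rw [← hc]
    refine Finset.sum_congr rfl fun s _ => ?_
    by_cases h : D s = 0
    · simp [c', h, show (F.submatrix s.1 s.2).det = 0 from h]
    · simp [c', h, D]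
  let Er : (Fin k → Fin l) → Matrix (Fin k) (Fin l) R := fun ri =>
    (1 : Matrix (Fin l) (Fin l) R).submatrix ri id
  let Ec : (Fin k → Fin m) → Matrix (Fin m) (Fin k) R := fun ci =>
    (1 : Matrix (Fin m) (Fin m) R).submatrix id ci
  have hEr : ∀ ri, Er ri * F = F.submatrix ri id := fun ri => by
    simp only [Er]
    ext
    simp [Matrix.mul_apply, Matrix.one_apply]
  have hEc : ∀ ci, F * Ec ci = F.submatrix id ci := fun ci => by
    simp only [Ec]
    ext
    simp [Matrix.mul_apply, Matrix.one_apply]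
  have hmem : ∀ x, x ∈ minorIdeal k F → d ∣ x := fun x hx => by
    rwa [hd, Ideal.mem_span_singleton] at hx
  refine ⟨∑ s, c' s • (Ec s.2 * (F.submatrix s.1 s.2).adjugate * Er s.1), ?_, ?_, ?_⟩
  · rw [Matrix.mul_sum, Matrix.sum_mul, ← hc', Finset.sum_smul]
    refine Finset.sum_congr rfl fun s _ => ?_
    rw [Matrix.mul_smul, Matrix.smul_mul, mul_smul]
    by_cases h : D s = 0
    · simp [c', h]
    · congr 1
      rw [← det_submatrix_mul_apply_eq hF h, ← hEr, ← hEc]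
      simp only [Matrix.mul_assoc]
  · intro i j
    rw [Matrix.sum_mul, Matrix.sum_apply]
    refine Finset.dvd_sum fun s _ => ?_
    rw [Matrix.smul_mul, Matrix.smul_apply, smul_eq_mul, Matrix.mul_assoc, hEr, Matrix.mul_assoc,
      Matrix.mul_apply]
    exact (Finset.dvd_sum fun a _ =>
      (hmem _ (adjugate_mul_submatrix_mem F s.1 s.2 a j)).mul_left _).mul_left _
  · intro i j
    rw [Matrix.mul_sum, Matrix.sum_apply]
    refine Finset.dvd_sum fun s _ => ?_
    rw [Matrix.mul_smul, Matrix.smul_apply, smul_eq_mul, ← Matrix.mul_assoc, ← Matrix.mul_assoc,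
      hEc, Matrix.mul_apply]
    exact (Finset.dvd_sum fun a _ =>
      (hmem _ (submatrix_mul_adjugate_mem F s.1 s.2 i a)).mul_right _).mul_left _

/-- Rank factorization: a matrix whose maximal nonvanishing minors generate a principal ideal
comes from a square matrix. -/
theorem IdempotentsSplit.exists_square_factor [IsDomain R] (hR : IdempotentsSplit R)
    {F : Matrix (Fin l) (Fin m) R} {d : R} (hd0 : d ≠ 0)
    (hd : minorIdeal k F = Ideal.span {d}) (hF : minorIdeal (k + 1) F = ⊥) :
    ∃ (P : Matrix (Fin l) (Fin k) R) (P' : Matrix (Fin k) (Fin l) R)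
      (Q : Matrix (Fin k) (Fin m) R) (Q' : Matrix (Fin m) (Fin k) R)
      (F₁ : Matrix (Fin k) (Fin k) R),
      P' * P = 1 ∧ Q * Q' = 1 ∧ F = P * F₁ * Q ∧ F₁.det ∣ d := by
  obtain ⟨W, hW, hT, hU⟩ := exists_mul_mul_eq_smul hd hF
  choose T hT using hT
  choose U hU using hU
  have hsm : ∀ {a b : ℕ} {M M' : Matrix (Fin a) (Fin b) R}, d • M = d • M' → M = M' := by
    intro a b M M' h
    ext i j
    have := congrFun (congrFun h i) j
    simpa [hd0] using this
  have hT : W * F = d • Matrix.of T := by ext i j; exact hT i j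
  have hU : F * W = d • Matrix.of U := by ext i j; exact hU i j
  generalize Matrix.of T = T at hT
  generalize Matrix.of U = U at hU
  have hFT : F * T = F := hsm (by rw [← Matrix.mul_smul, ← hT, ← Matrix.mul_assoc, hW])
  have hUF : U * F = F := hsm (by rw [← Matrix.smul_mul, ← hU, hW])
  have hTT : T * T = T := by
    refine hsm ?_
    rw [← Matrix.smul_mul, ← hT, Matrix.mul_assoc, hFT]
  have hUU : U * U = U := by
    refine hsm ?_
    rw [← Matrix.mul_smul, ← hU, ← Matrix.mul_assoc, hUF]
  have hrank : ∀ {n s : ℕ} {T : Matrix (Fin n) (Fin n) R}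
      (_ : minorIdeal (k + 1) (d • T) = ⊥) {P : Matrix (Fin n) (Fin s) R}
      {Q : Matrix (Fin s) (Fin n) R}, P * Q = T → Q * P = 1 → s ≤ k := by
    intro n s T h P Q h1 h2
    by_contra! hlt
    rw [minorIdeal_smul, Ideal.mul_eq_bot, Ideal.span_singleton_eq_bot] at h
    have h := h.resolve_left (pow_ne_zero _ hd0)
    have h3 : (1 : Matrix (Fin s) (Fin s) R) = Q * T * P := by
      rw [← h1, ← Matrix.mul_assoc, h2, Matrix.one_mul, h2]
    have h4 := minorIdeal_one_eq_top (R := R) (show k + 1 ≤ s from hlt)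
    rw [h3] at h4
    have h5 := (minorIdeal_mul_le_left (k := k + 1) (Q * T) P).trans (minorIdeal_mul_le_right Q T)
    rw [h4, h] at h5
    exact bot_ne_top (top_le_iff.1 h5)
  obtain ⟨s, Q', Q, h1, h2⟩ := hR m T hTT
  obtain ⟨s', P, P', h3, h4⟩ := hR l U hUU
  have hF1 : F = P * (P' * F * Q') * Q := by
    calc F = U * F * T := by rw [hUF, hFT]
      _ = _ := by rw [← h1, ← h3]; simp only [Matrix.mul_assoc]
  have hne : minorIdeal k (P' * F * Q') ≠ ⊥ := by
    intro h
    have := (minorIdeal_mul_le_left (k := k) (P * (P' * F * Q')) Q).trans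
      (minorIdeal_mul_le_right P _)
    rw [← hF1, h, hd, le_bot_iff, Ideal.span_singleton_eq_bot] at this
    exact hd0 this
  have hs : s = k := le_antisymm
    (hrank (by rw [← hT]; exact le_bot_iff.1 (hF ▸ minorIdeal_mul_le_right W F)) h1 h2) (by
      by_contra! hlt
      exact hne (minorIdeal_eq_bot_of_lt (Or.inr hlt)))
  have hs' : s' = k := le_antisymm
    (hrank (by rw [← hU]; exact le_bot_iff.1 (hF ▸ minorIdeal_mul_le_left F W)) h3 h4) (by
      by_contra! hlt
      exact hne (minorIdeal_eq_bot_of_lt (Or.inl hlt)))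
  subst hs
  subst hs'
  refine ⟨P, P', Q, Q', P' * F * Q', h4, h2, hF1, ?_⟩
  rw [← Ideal.mem_span_singleton]
  apply minorIdeal_self_le
  have := (minorIdeal_mul_le_left (k := s') (P * (P' * F * Q')) Q).trans
    (minorIdeal_mul_le_right P _)
  rw [← hF1, hd] at this
  exact this (Ideal.mem_span_singleton_self d)

end MinorIdeal

section Unimodular

variable {R : Type*} [CommRing R] {l m : ℕ}

/-- A unimodular column completes to an invertible matrix. -/
theorem IdempotentsSplit.exists_completion [Nontrivial R] (hR : IdempotentsSplit R) {n : ℕ}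
    {u w : Fin (n + 1) → R} (h : u ⬝ᵥ w = 1) :
    ∃ g g' : Matrix (Fin (n + 1)) (Fin (n + 1)) R,
      g * g' = 1 ∧ g 0 = u ∧ ∀ i, g' i 0 = w i := by
  have he : Matrix.vecMulVec w u * Matrix.vecMulVec w u = Matrix.vecMulVec w u := by
    rw [Matrix.vecMulVec_mul_vecMulVec, h, one_smul]
  obtain ⟨s, P, Q, hPQ, hQP⟩ := hR (n + 1) (1 - Matrix.vecMulVec w u)
    (by rw [mul_sub, sub_mul, sub_mul, he]; simp)
  let g : Matrix (Fin (s + 1)) (Fin (n + 1)) R := Matrix.of (Fin.cons u Q)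
  let g' : Matrix (Fin (n + 1)) (Fin (s + 1)) R := Matrix.of fun i => Fin.cons (w i) (P i)
  have hg0 : ∀ j, g 0 j = u j := fun _ => rfl
  have hgs : ∀ i j, g (Fin.succ i) j = Q i j := fun _ _ => rfl
  have hg0' : ∀ i, g' i 0 = w i := fun _ => rfl
  have hgs' : ∀ i j, g' i (Fin.succ j) = P i j := fun _ _ => rfl
  have hgg : g' * g = 1 := by
    have : g' * g = Matrix.vecMulVec w u + P * Q := by
      ext i j
      simp [hg0, hgs, hg0', hgs', Matrix.mul_apply, Fin.sum_univ_succ, Matrix.vecMulVec_apply]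
    rw [this, hPQ]
    simp
  have huP : u ᵥ* P = 0 := by
    have h1 : u ᵥ* (P * Q) = 0 := by
      rw [hPQ, Matrix.vecMul_sub, Matrix.vecMul_one, Matrix.vecMul_vecMulVec, h, one_smul, sub_self]
    have h2 : u ᵥ* P = (u ᵥ* (P * Q)) ᵥ* P := by
      rw [← Matrix.vecMul_vecMul, Matrix.vecMul_vecMul _ Q, hQP, Matrix.vecMul_one]
    rw [h2, h1, Matrix.zero_vecMul]
  have hQw : Q *ᵥ w = 0 := by
    have h1 : (P * Q) *ᵥ w = 0 := by
      rw [hPQ, Matrix.sub_mulVec, Matrix.one_mulVec, Matrix.vecMulVec_mulVec, h]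
      simp
    have h2 : Q *ᵥ w = Q *ᵥ ((P * Q) *ᵥ w) := by
      rw [Matrix.mulVec_mulVec, ← Matrix.mul_assoc, hQP, Matrix.one_mul]
    rw [h2, h1, Matrix.mulVec_zero]
  have hgg' : g * g' = 1 := by
    ext i j
    refine Fin.cases ?_ (fun i => ?_) i <;> refine Fin.cases ?_ (fun j => ?_) j
    · simpa [hg0, hgs, hg0', hgs', Matrix.mul_apply, dotProduct] using h
    · rw [Matrix.one_apply_ne (Fin.succ_ne_zero j).symm]
      simpa [hg0, hgs, hg0', hgs', Matrix.mul_apply, Matrix.vecMul, dotProduct] using congrFun huP j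
    · simpa [hg0, hgs, hg0', hgs', Matrix.mul_apply, Matrix.mulVec, dotProduct] using congrFun hQw i
    · have := congrFun (congrFun hQP i) j
      simpa [hg0, hgs, hg0', hgs', Matrix.mul_apply, Matrix.one_apply] using this
  have hs : s + 1 = n + 1 := by
    have := Matrix.square_of_invertible g g' hgg' hgg
    simpa using this
  obtain rfl : s = n := by omega
  exact ⟨g, g', hgg', rfl, fun i => rfl⟩

theorem mulVec_eq_single_of_mul_eq_one {n : ℕ} {g g' : Matrix (Fin (n + 1)) (Fin (n + 1)) R}
    {w : Fin (n + 1) → R} (h : g * g' = 1) (hw : ∀ i, g' i 0 = w i) :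
    g *ᵥ w = Pi.single 0 1 := by
  have : w = g' *ᵥ Pi.single 0 1 := by
    ext i
    simp [hw]
  rw [this, Matrix.mulVec_mulVec, h, Matrix.one_mulVec]

/-- A column that becomes unimodular modulo `t` can be corrected by a multiple of `t` within the
image of a square matrix whose determinant divides a power of `t`. -/
theorem exists_unimodular_image_of_mod {r : ℕ} {t : R} {N : ℕ}
    {F g g' : Matrix (Fin (r + 1)) (Fin (r + 1)) R} (hF : F.det ∣ t ^ N) (hg : g * g' = 1)
    {v h : Fin (r + 1) → R} (hv : g *ᵥ (F *ᵥ v) = Pi.single 0 1 + t • h) :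
    ∃ k u : Fin (r + 1) → R, u ⬝ᵥ (F *ᵥ (v + t • k)) = 1 := by
  obtain ⟨c, hc⟩ := hF
  have hadj : ∀ z : Fin (r + 1) → R,
      g *ᵥ (F *ᵥ (F.adjugate *ᵥ (g' *ᵥ (c • z)))) = t ^ N • z := by
    intro z
    rw [Matrix.mulVec_mulVec _ F, Matrix.mul_adjugate, Matrix.smul_mulVec, Matrix.one_mulVec,
      Matrix.mulVec_smul, Matrix.mulVec_mulVec, hg, Matrix.one_mulVec, smul_smul, hc]
  rcases r with _ | r
  · have hunit : IsUnit F.det := by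
      have h1 : IsCoprime (t ^ N) (1 + t * h 0) := IsCoprime.pow_left ⟨-h 0, 1, by ring⟩
      have h2 : F.det ∣ 1 + t * h 0 := by
        have h3 := congrFun hv 0
        simp only [Matrix.mulVec, dotProduct, Fin.sum_univ_succ, Fin.sum_univ_zero, Pi.add_apply,
          Pi.single_eq_same, Pi.smul_apply, smul_eq_mul, add_zero] at h3
        refine ⟨g 0 0 * v 0, ?_⟩
        rw [← h3, Matrix.det_fin_one]
        ring
      exact h1.isUnit_of_dvd' ⟨c, hc⟩ h2
    obtain ⟨f, hf⟩ := hunit.exists_left_inv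
    have hsol : g *ᵥ (F *ᵥ (F.adjugate *ᵥ (g' *ᵥ (-f • h)))) = -h := by
      rw [Matrix.mulVec_mulVec _ F, Matrix.mul_adjugate, Matrix.smul_mulVec, Matrix.one_mulVec,
        Matrix.mulVec_smul, Matrix.mulVec_smul, Matrix.mulVec_smul, Matrix.mulVec_mulVec, hg,
        Matrix.one_mulVec, smul_smul, mul_neg, mul_comm, hf, neg_one_smul]
    refine ⟨F.adjugate *ᵥ (g' *ᵥ (-f • h)), Pi.single 0 1 ᵥ* g, ?_⟩
    rw [← Matrix.dotProduct_mulVec, Matrix.mulVec_add, Matrix.mulVec_add, hv, Matrix.mulVec_smul,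
      Matrix.mulVec_smul, hsol]
    simp
  · set y := t * h 0
    set z : R := (-h 0) ^ (N + 1) * (1 - t * h 1)
    obtain ⟨q, hq⟩ : (1 + y) ∣ 1 - (-y) ^ (N + 1) := by
      have := sub_dvd_pow_sub_pow (1 : R) (-y) (N + 1)
      simpa using this
    refine ⟨F.adjugate *ᵥ (g' *ᵥ (c • Pi.single 1 z)),
      (Pi.single 1 1 + Pi.single 0 ((1 - t * h 1) * q)) ᵥ* g, ?_⟩
    rw [← Matrix.dotProduct_mulVec, Matrix.mulVec_add, Matrix.mulVec_add, hv, Matrix.mulVec_smul,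
      Matrix.mulVec_smul, hadj]
    simp only [add_dotProduct, single_dotProduct, Pi.add_apply, Pi.single_eq_same, Pi.smul_apply,
      smul_eq_mul, one_mul]
    have e1 : (Pi.single (0 : Fin (r + 2)) (1 : R) : Fin (r + 2) → R) 1 = 0 := by simp
    have e2 : (Pi.single (1 : Fin (r + 2)) z : Fin (r + 2) → R) 0 = 0 := by simp
    rw [e1, e2]
    have e3 : t * (t ^ N * z) = (-y) ^ (N + 1) * (1 - t * h 1) := by
      simp only [z, y, pow_succ, ← mul_neg, mul_pow]
      ring
    rw [e3]
    linear_combination -(1 - t * h 1) * hq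

variable {x : R} {σ : R →+* R}

theorem exists_add_smul_of_dvd_sub (hσ : ∀ a, x ∣ a - σ a) {n : ℕ} (v : Fin n → R) :
    ∃ h : Fin n → R, v = (fun i => σ (v i)) + x • h := by
  choose h hh using fun i => hσ (v i)
  exact ⟨h, by ext i; simp [← hh]⟩

theorem IdempotentsSplit.exists_unimodular_image_of_retract [IsDomain R] (hR : IdempotentsSplit R)
    (hx : x ≠ 0) (hσ : ∀ a, x ∣ a - σ a) {r N : ℕ} {G : Matrix (Fin l) (Fin m) R}
    (h1 : minorIdeal (r + 1) G = Ideal.span {x ^ N}) (h2 : minorIdeal (r + 2) G = ⊥)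
    {u₀ : Fin l → R} {v : Fin m → R} (h : σ (u₀ ⬝ᵥ (G *ᵥ v)) = 1) :
    ∃ (k : Fin m → R) (u : Fin l → R), u ⬝ᵥ (G *ᵥ (v + x • k)) = 1 := by
  obtain ⟨P, P', Q, Q', F, hP, hQ, hG, hdet⟩ :=
    hR.exists_square_factor (pow_ne_zero N hx) h1 h2
  have hw : (fun i => σ ((u₀ ᵥ* P) i)) ⬝ᵥ (fun i => σ ((F *ᵥ (Q *ᵥ v)) i)) = 1 := by
    have e1 : u₀ ⬝ᵥ (G *ᵥ v) = (u₀ ᵥ* P) ⬝ᵥ (F *ᵥ (Q *ᵥ v)) := by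
      rw [← Matrix.dotProduct_mulVec, Matrix.mulVec_mulVec, Matrix.mulVec_mulVec, hG,
        Matrix.mul_assoc]
    rw [e1, RingHom.map_dotProduct] at h
    exact h
  obtain ⟨g, g', hgg, -, hg'⟩ := hR.exists_completion hw
  have hg1 := mulVec_eq_single_of_mul_eq_one hgg hg'
  obtain ⟨h', hh'⟩ := exists_add_smul_of_dvd_sub hσ (F *ᵥ (Q *ᵥ v))
  obtain ⟨k, u, hku⟩ := exists_unimodular_image_of_mod hdet hgg (v := Q *ᵥ v) (h := g *ᵥ h')
    (by rw [hh', Matrix.mulVec_add, hg1, Matrix.mulVec_smul])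
  refine ⟨Q' *ᵥ k, u ᵥ* P', ?_⟩
  rw [← Matrix.dotProduct_mulVec, Matrix.mulVec_mulVec]
  have e1 : P' * G = F * Q := by
    rw [hG, ← Matrix.mul_assoc, ← Matrix.mul_assoc, hP, Matrix.one_mul]
  rw [e1, ← Matrix.mulVec_mulVec, Matrix.mulVec_add, Matrix.mulVec_smul, Matrix.mulVec_mulVec k Q,
    hQ, Matrix.one_mulVec, hku]

theorem IdempotentsSplit.exists_unimodular_of_minorIdeal_eq_top [IsDomain R]
    (hR : IdempotentsSplit R) {r : ℕ} {G : Matrix (Fin l) (Fin m) R}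
    (h1 : minorIdeal (r + 1) G = ⊤) (h2 : minorIdeal (r + 2) G = ⊥) :
    ∃ (u : Fin l → R) (v : Fin m → R), u ⬝ᵥ (G *ᵥ v) = 1 := by
  obtain ⟨P, P', Q, Q', F, hP, hQ, hG, hdet⟩ :=
    hR.exists_square_factor (d := 1) one_ne_zero (by rw [h1, Ideal.span_singleton_one]) h2
  have hF : F⁻¹ * F = 1 := Matrix.nonsing_inv_mul _ (isUnit_of_dvd_one hdet)
  refine ⟨(Pi.single 0 1 ᵥ* F⁻¹) ᵥ* P', Q' *ᵥ Pi.single 0 1, ?_⟩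
  rw [← Matrix.dotProduct_mulVec, ← Matrix.dotProduct_mulVec, Matrix.mulVec_mulVec,
    Matrix.mulVec_mulVec, Matrix.mulVec_mulVec]
  have e1 : F⁻¹ * P' * G * Q' = 1 := by
    calc F⁻¹ * P' * G * Q' = F⁻¹ * ((P' * P) * F * (Q * Q')) := by
          rw [hG]; simp only [Matrix.mul_assoc]
      _ = 1 := by rw [hP, hQ, Matrix.one_mul, Matrix.mul_one, hF]
  rw [e1, Matrix.one_mulVec]
  simp

end Unimodular

section Retract

variable {R : Type*} [CommRing R] {l m : ℕ} {x y : R} {σ τ : R →+* R}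

/-- `σ` and `τ` are commuting retractions of `R` onto complements of the ideals `(x)` and `(y)`. -/
structure IsRetractPair (x y : R) (σ τ : R →+* R) : Prop where
  left_ne_zero : x ≠ 0
  right_ne_zero : y ≠ 0
  left_map_left : σ x = 0
  left_map_right : σ y = y
  right_map_left : τ x = x
  right_map_right : τ y = 0
  left_dvd_sub : ∀ a, x ∣ a - σ a
  right_dvd_sub : ∀ a, y ∣ a - τ a
  map_comm : ∀ a, σ (τ a) = τ (σ a)

theorem IsRetractPair.symm (h : IsRetractPair x y σ τ) : IsRetractPair y x τ σ :=
  ⟨h.2, h.1, h.6, h.5, h.4, h.3, h.8, h.7, fun a => (h.9 a).symm⟩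

theorem map_map_of_dvd_sub (hx : σ x = 0) (hσ : ∀ a, x ∣ a - σ a) (a : R) : σ (σ a) = σ a := by
  obtain ⟨b, hb⟩ := hσ a
  have := congrArg σ hb
  rw [map_sub, map_mul, hx, zero_mul, sub_eq_zero] at this
  exact this.symm

theorem comp_mulVec (σ : R →+* R) (G : Matrix (Fin l) (Fin m) R) (v : Fin m → R) :
    σ ∘ (G *ᵥ v) = G.map σ *ᵥ (σ ∘ v) :=
  funext fun i => RingHom.map_mulVec σ G v i

theorem map_dotProduct_mulVec (σ : R →+* R) (G : Matrix (Fin l) (Fin m) R) (u : Fin l → R)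
    (v : Fin m → R) : σ (u ⬝ᵥ (G *ᵥ v)) = (σ ∘ u) ⬝ᵥ (G.map σ *ᵥ (σ ∘ v)) := by
  rw [RingHom.map_dotProduct, comp_mulVec]

theorem minorIdeal_antitone (G : Matrix (Fin l) (Fin m) R) : Antitone fun k => minorIdeal k G :=
  antitone_nat_of_succ_le fun _ => minorIdeal_succ_le G

theorem exists_greatest_eq_zero {p : ℕ → ℕ} {r : ℕ} (hp : p 1 = 0) :
    ∃ j, j ≤ r ∧ p (j + 1) = 0 ∧ ∀ k, j + 1 < k → k ≤ r + 1 → p k ≠ 0 := by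
  have h1 := Nat.le_findGreatest (P := fun k => p k = 0) (m := 1) (n := r + 1) (by omega) hp
  have h2 := Nat.findGreatest_spec (P := fun k => p k = 0) (m := 1) (n := r + 1) (by omega) hp
  have h3 := Nat.findGreatest_le (P := fun k => p k = 0) (r + 1)
  refine ⟨Nat.findGreatest (fun k => p k = 0) (r + 1) - 1, by omega, ?_, fun k hk hkr => ?_⟩
  · rwa [Nat.sub_add_cancel h1]
  · exact Nat.findGreatest_is_greatest (P := fun k => p k = 0) (by omega) hkr

theorem IdempotentsSplit.exists_unimodular_of_minorIdeal_eq_pow [IsDomain R]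
    (hR : IdempotentsSplit R) (hx : x ≠ 0) (hσx : σ x = 0) (hσ : ∀ a, x ∣ a - σ a)
    {r : ℕ} {p : ℕ → ℕ} (hp : p 1 = 0) {G : Matrix (Fin l) (Fin m) R}
    (hG : ∀ k, 1 ≤ k → k ≤ r + 1 → minorIdeal k G = Ideal.span {x ^ p k})
    (hG' : minorIdeal (r + 2) G = ⊥) :
    ∃ (u : Fin l → R) (v : Fin m → R), u ⬝ᵥ (G *ᵥ v) = 1 := by
  obtain ⟨j, hjr, hj, hj'⟩ := exists_greatest_eq_zero (r := r) hp
  obtain ⟨u, v, huv⟩ := hR.exists_unimodular_of_minorIdeal_eq_top (G := G.map σ) (r := j)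
    (by rw [minorIdeal_map, hG _ (by omega) (by omega), hj, pow_zero, Ideal.span_singleton_one,
          Ideal.map_top])
    (by
      rw [minorIdeal_map]
      rcases hjr.eq_or_lt with rfl | hlt
      · rw [hG', Ideal.map_bot]
      · rw [hG _ (by omega) (by omega), Ideal.map_span, Set.image_singleton, map_pow, hσx,
          zero_pow (hj' _ (by omega) (by omega))]
        simp)
  obtain ⟨k, u, h⟩ := hR.exists_unimodular_image_of_retract hx hσ (hG _ (by omega) le_rfl) hG'
    (u₀ := u) (v := v) (by
      have := congrArg σ huv
      rw [map_dotProduct_mulVec, map_one] at this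
      rw [map_dotProduct_mulVec, ← this]
      congr 2
      ext
      simp [map_map_of_dvd_sub hσx hσ])
  exact ⟨u, _, h⟩

theorem IsRetractPair.le_of_dvd [IsDomain R] (h : IsRetractPair x y σ τ) {a b c d : ℕ}
    (hd : x ^ a * y ^ b ∣ x ^ c * y ^ d) : a ≤ c ∧ b ≤ d := by
  have key : ∀ {x y : R} {σ τ : R →+* R} (_ : IsRetractPair x y σ τ) {a b c d : ℕ}
      (_ : x ^ a * y ^ b ∣ x ^ c * y ^ d), a ≤ c := by
    intro x y σ τ h a b c d hd
    by_contra! hlt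
    have h1 : x ^ c * x ∣ x ^ c * y ^ d :=
      (((pow_succ x c).symm.dvd.trans (pow_dvd_pow x hlt)).mul_right _).trans hd
    obtain ⟨e, he⟩ := (mul_dvd_mul_iff_left (pow_ne_zero c h.left_ne_zero)).1 h1
    have h2 := congrArg σ he
    rw [map_pow, map_mul, h.left_map_left, h.left_map_right, zero_mul] at h2
    exact pow_ne_zero d h.right_ne_zero h2
  exact ⟨key h hd, key h.symm (by rwa [mul_comm (y ^ b), mul_comm (y ^ d)])⟩

theorem IsRetractPair.exists_minorIdeal_map [IsDomain R] (h : IsRetractPair x y σ τ) {r : ℕ}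
    {p q : ℕ → ℕ} (hp : p 1 = 0) {F : Matrix (Fin l) (Fin m) R}
    (hF : ∀ k, 1 ≤ k → k ≤ r + 1 → minorIdeal k F = Ideal.span {x ^ p k * y ^ q k})
    (hF' : minorIdeal (r + 2) F = ⊥) :
    ∃ j, (∀ k, 1 ≤ k → k ≤ j + 1 → minorIdeal k (F.map σ) = Ideal.span {y ^ q k}) ∧
      minorIdeal (j + 2) (F.map σ) = ⊥ := by
  obtain ⟨j, hjr, hj, hj'⟩ := exists_greatest_eq_zero (r := r) hp
  have hmap : ∀ k, 1 ≤ k → k ≤ r + 1 →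
      minorIdeal k (F.map σ) = Ideal.span {0 ^ p k * y ^ q k} := by
    intro k h1 h2
    rw [minorIdeal_map, hF k h1 h2, Ideal.map_span, Set.image_singleton, map_mul, map_pow, map_pow,
      h.left_map_left, h.left_map_right]
  refine ⟨j, fun k h1 h2 => ?_, ?_⟩
  · have h3 := minorIdeal_antitone F h2
    simp only [hF k h1 (by omega), hF (j + 1) (by omega) (by omega),
      Ideal.span_singleton_le_span_singleton] at h3
    have h4 := (h.le_of_dvd h3).1
    rw [hmap k h1 (by omega), show p k = 0 by omega, pow_zero, one_mul]
  · rcases hjr.eq_or_lt with rfl | hlt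
    · rw [minorIdeal_map, hF', Ideal.map_bot]
    · rw [hmap _ (by omega) (by omega), zero_pow (hj' _ (by omega) (by omega))]
      simp

theorem IsRetractPair.mul_dvd [IsDomain R] (h : IsRetractPair x y σ τ) {a : R} (h1 : σ a = 0)
    (h2 : τ a = 0) : x * y ∣ a := by
  obtain ⟨b, hb⟩ := h.left_dvd_sub a
  rw [h1, sub_zero] at hb
  rw [hb, map_mul, h.right_map_left] at h2
  obtain ⟨c, hc⟩ := h.right_dvd_sub b
  rw [(mul_eq_zero.1 h2).resolve_left h.left_ne_zero, sub_zero] at hc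
  exact ⟨c, by rw [hb, hc, mul_assoc]⟩

theorem comp_single_one (σ : R →+* R) {n : ℕ} :
    σ ∘ (Pi.single 0 1 : Fin (n + 1) → R) = Pi.single 0 1 := by
  ext i
  refine Fin.cases ?_ (fun i => ?_) i <;> simp

/-- If both reductions of a column are unimodular, then some invertible matrix takes the column
to a basis vector modulo `x y`. -/
theorem IsRetractPair.exists_mulVec_eq_single_add [IsDomain R] (hR : IdempotentsSplit R)
    (h : IsRetractPair x y σ τ) {n : ℕ} {w u₀ u₁ : Fin (n + 1) → R}
    (h₀ : u₀ ⬝ᵥ (σ ∘ w) = 1) (h₁ : u₁ ⬝ᵥ (τ ∘ w) = 1) :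
    ∃ (g g' : Matrix (Fin (n + 1)) (Fin (n + 1)) R) (c : Fin (n + 1) → R), g * g' = 1 ∧
      g *ᵥ w = Pi.single 0 1 + (x * y) • c := by
  have hσσ : ∀ a, σ (σ a) = σ a := map_map_of_dvd_sub h.left_map_left h.left_dvd_sub
  have hττ : ∀ a, τ (τ a) = τ a := map_map_of_dvd_sub h.right_map_right h.right_dvd_sub
  have hone : ∀ {f : R →+* R} {A B : Matrix (Fin (n + 1)) (Fin (n + 1)) R}, A * B = 1 →
      A.map f * B.map f = 1 := fun {f A B} hAB => by
    rw [← Matrix.map_mul, hAB, Matrix.map_one _ f.map_zero f.map_one]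
  obtain ⟨A, A', hA, hAσ, hAw⟩ : ∃ A A' : Matrix (Fin (n + 1)) (Fin (n + 1)) R, A * A' = 1 ∧
      A.map σ = A ∧ A *ᵥ (σ ∘ w) = Pi.single 0 1 := by
    obtain ⟨g, g', hg, -, hgw⟩ := hR.exists_completion h₀
    refine ⟨g.map σ, g'.map σ, hone hg, by ext; simp [hσσ], ?_⟩
    have := congrArg (σ ∘ ·) (mulVec_eq_single_of_mul_eq_one hg hgw)
    simp only [comp_mulVec, comp_single_one] at this
    rw [← this]
    congr 1
    ext
    simp [hσσ]
  have hA' := mul_eq_one_comm.1 hA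
  set b := τ ∘ (A *ᵥ w) with hb
  have hσb : σ ∘ b = Pi.single 0 1 := by
    have : σ ∘ b = τ ∘ (σ ∘ (A *ᵥ w)) := funext fun i => h.map_comm _
    rw [this, comp_mulVec, hAσ, hAw, comp_single_one]
  have hτb : τ ∘ b = b := funext fun i => hττ _
  obtain ⟨B, B', hB, hBτ, hBτ', hBb⟩ : ∃ B B' : Matrix (Fin (n + 1)) (Fin (n + 1)) R, B * B' = 1 ∧
      B.map τ = B ∧ B'.map τ = B' ∧ B *ᵥ b = Pi.single 0 1 := by
    obtain ⟨g, g', hg, -, hgw⟩ := hR.exists_completion (u := u₁ ᵥ* A'.map τ) (w := b) (by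
      rw [← Matrix.dotProduct_mulVec, hb, comp_mulVec, Matrix.mulVec_mulVec, hone hA',
        Matrix.one_mulVec, h₁])
    refine ⟨g.map τ, g'.map τ, hone hg, by ext; simp [hττ], by ext; simp [hττ], ?_⟩
    have := congrArg (τ ∘ ·) (mulVec_eq_single_of_mul_eq_one hg hgw)
    simpa only [comp_mulVec, comp_single_one, hτb] using this
  have hB' := mul_eq_one_comm.1 hB
  have hBσ : B'.map σ *ᵥ (Pi.single 0 1) = Pi.single 0 1 := by
    have h1 := congrArg (σ ∘ ·) hBb
    simp only [comp_mulVec, comp_single_one, hσb] at h1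
    conv_lhs => rw [← h1]
    rw [Matrix.mulVec_mulVec, hone hB', Matrix.one_mulVec]
  have hσc : σ ∘ ((B'.map σ * B * A) *ᵥ w) = Pi.single 0 1 := by
    have h1 : (B'.map σ * B).map σ = 1 := by
      rw [Matrix.map_mul]
      have : (B'.map σ).map σ = B'.map σ := by ext; simp [hσσ]
      rw [this, hone hB']
    rw [comp_mulVec, Matrix.map_mul, h1, Matrix.one_mul, hAσ, hAw]
  have hτc : τ ∘ ((B'.map σ * B * A) *ᵥ w) = Pi.single 0 1 := by
    have h1 : (B'.map σ * B).map τ = B'.map σ * B := by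
      rw [Matrix.map_mul, hBτ]
      congr 1
      conv_rhs => rw [← hBτ']
      ext
      simp [h.map_comm]
    rw [← Matrix.mulVec_mulVec, comp_mulVec, h1, ← hb, ← Matrix.mulVec_mulVec, hBb, hBσ]
  have hdvd : ∀ i, x * y ∣ ((B'.map σ * B * A) *ᵥ w) i - (Pi.single 0 1 : Fin (n + 1) → R) i := by
    intro i
    apply h.mul_dvd
    · rw [map_sub, sub_eq_zero]
      exact congrFun (hσc.trans (comp_single_one σ).symm) i
    · rw [map_sub, sub_eq_zero]
      exact congrFun (hτc.trans (comp_single_one τ).symm) i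
  choose c hc using hdvd
  refine ⟨B'.map σ * B * A, A' * (B' * B.map σ), c, ?_, ?_⟩
  · calc B'.map σ * B * A * (A' * (B' * B.map σ))
        = B'.map σ * (B * ((A * A') * B')) * B.map σ := by simp only [Matrix.mul_assoc]
      _ = 1 := by rw [hA, Matrix.one_mul, hB, Matrix.mul_one, hone hB']
  · ext i
    rw [Pi.add_apply, Pi.smul_apply, smul_eq_mul, ← hc i]
    ring

theorem IsRetractPair.exists_unimodular_of_square [IsDomain R] (hR : IdempotentsSplit R)
    (h : IsRetractPair x y σ τ) {r a b : ℕ} {p q : ℕ → ℕ} (hp : p 1 = 0) (hq : q 1 = 0)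
    {F : Matrix (Fin (r + 1)) (Fin (r + 1)) R}
    (hF : ∀ k, 1 ≤ k → k ≤ r + 1 → minorIdeal k F = Ideal.span {x ^ p k * y ^ q k})
    (hdet : F.det ∣ x ^ a * y ^ b) :
    ∃ u v : Fin (r + 1) → R, u ⬝ᵥ (F *ᵥ v) = 1 := by
  have hσσ : ∀ a, σ (σ a) = σ a := map_map_of_dvd_sub h.left_map_left h.left_dvd_sub
  have hττ : ∀ a, τ (τ a) = τ a := map_map_of_dvd_sub h.right_map_right h.right_dvd_sub
  have hF' : minorIdeal (r + 2) F = ⊥ := minorIdeal_eq_bot_of_lt (Or.inl (Nat.lt_succ_self _))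
  obtain ⟨u₀, v₀, hv₀, huv₀⟩ : ∃ u v : Fin (r + 1) → R, σ ∘ v = v ∧ u ⬝ᵥ (F.map σ *ᵥ v) = 1 := by
    obtain ⟨j, hj, hj'⟩ := h.exists_minorIdeal_map hp hF hF'
    obtain ⟨u, v, huv⟩ := hR.exists_unimodular_of_minorIdeal_eq_pow h.right_ne_zero
      h.right_map_right h.right_dvd_sub hq hj hj'
    refine ⟨σ ∘ u, σ ∘ v, by ext; simp [hσσ], ?_⟩
    have := congrArg σ huv
    rw [map_dotProduct_mulVec, map_one] at this
    rw [← this]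
    congr 2
    ext
    simp [hσσ]
  have hFy : ∀ k, 1 ≤ k → k ≤ r + 1 → minorIdeal k F = Ideal.span {y ^ q k * x ^ p k} :=
    fun k h1 h2 => by rw [hF k h1 h2, mul_comm]
  obtain ⟨j, hj, hj'⟩ := h.symm.exists_minorIdeal_map hq hFy hF'
  obtain ⟨k, u₁, huk⟩ := hR.exists_unimodular_image_of_retract h.left_ne_zero h.left_dvd_sub
    (hj (j + 1) (by omega) le_rfl) hj' (u₀ := τ ∘ u₀) (v := τ ∘ v₀) (by
      rw [← map_dotProduct_mulVec, h.map_comm, map_dotProduct_mulVec, hv₀]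
      have h1 : σ (u₀ ⬝ᵥ (F.map σ *ᵥ v₀)) = (σ ∘ u₀) ⬝ᵥ (F.map σ *ᵥ v₀) := by
        rw [map_dotProduct_mulVec, hv₀]
        congr 2
        ext
        simp [hσσ]
      rw [← h1, huv₀, map_one, map_one])
  have huk' := congrArg τ huk
  rw [map_dotProduct_mulVec, map_one] at huk'
  set v := v₀ + x • (τ ∘ k) with hv
  have hσv : σ ∘ v = v₀ := by
    ext i
    have := congrFun hv₀ i
    simp only [Function.comp_apply] at this
    simp [v, h.left_map_left, this]
  have hτv : τ ∘ (τ ∘ v₀ + x • k) = τ ∘ v := by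
    ext i
    simp [v, h.right_map_left, hττ]
  have hττF : (F.map τ).map τ = F.map τ := by ext; simp [hττ]
  rw [hτv, hττF] at huk'
  obtain ⟨g, g', c, hg, hc⟩ := h.exists_mulVec_eq_single_add hR (w := F *ᵥ v) (u₀ := u₀)
    (u₁ := τ ∘ u₁) (by rw [comp_mulVec, hσv, huv₀]) (by rw [comp_mulVec, huk'])
  have hdet' : F.det ∣ (x * y) ^ (a + b) := by
    refine hdet.trans ?_
    rw [mul_pow]
    exact mul_dvd_mul (pow_dvd_pow _ (by omega)) (pow_dvd_pow _ (by omega))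
  obtain ⟨k', u, hu⟩ := exists_unimodular_image_of_mod hdet' hg hc
  exact ⟨u, _, hu⟩

theorem IsRetractPair.exists_unimodular [IsDomain R] (hR : IdempotentsSplit R)
    (h : IsRetractPair x y σ τ) {r : ℕ} {p q : ℕ → ℕ} (hp : p 1 = 0) (hq : q 1 = 0)
    {F : Matrix (Fin l) (Fin m) R}
    (hF : ∀ k, 1 ≤ k → k ≤ r + 1 → minorIdeal k F = Ideal.span {x ^ p k * y ^ q k})
    (hF' : minorIdeal (r + 2) F = ⊥) :
    ∃ (u : Fin l → R) (v : Fin m → R), u ⬝ᵥ (F *ᵥ v) = 1 := by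
  obtain ⟨P, P', Q, Q', F₁, hP, hQ, hFF, hdet⟩ := hR.exists_square_factor
    (mul_ne_zero (pow_ne_zero _ h.left_ne_zero) (pow_ne_zero _ h.right_ne_zero))
    (hF (r + 1) (by omega) le_rfl) hF'
  have hF₁ : P' * F * Q' = F₁ := by
    calc P' * F * Q' = P' * P * F₁ * (Q * Q') := by rw [hFF]; simp only [Matrix.mul_assoc]
      _ = F₁ := by rw [hP, hQ, Matrix.one_mul, Matrix.mul_one]
  have hI : ∀ k, minorIdeal k F₁ = minorIdeal k F := fun k => le_antisymm
    (hF₁ ▸ (minorIdeal_mul_le_left (P' * F) Q').trans (minorIdeal_mul_le_right P' F))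
    (hFF ▸ (minorIdeal_mul_le_left (P * F₁) Q).trans (minorIdeal_mul_le_right P F₁))
  obtain ⟨u, v, huv⟩ := h.exists_unimodular_of_square hR hp hq (F := F₁)
    (fun k h1 h2 => by rw [hI, hF k h1 h2]) hdet
  refine ⟨u ᵥ* P', Q' *ᵥ v, ?_⟩
  rw [← Matrix.dotProduct_mulVec, Matrix.mulVec_mulVec, Matrix.mulVec_mulVec,
    ← huv, ← hF₁, Matrix.mul_assoc]

end Retract

section SmithForm

variable {R : Type*} [CommRing R] {l m : ℕ}

theorem MatEquiv.trans {F G H : Matrix (Fin l) (Fin m) R} (h₁ : MatEquiv F G)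
    (h₂ : MatEquiv G H) : MatEquiv F H := by
  obtain ⟨M, N, hM, hN, rfl⟩ := h₁
  obtain ⟨M', N', hM', hN', rfl⟩ := h₂
  refine ⟨M' * M, N * N', ?_, ?_, by simp only [Matrix.mul_assoc]⟩
  · rw [Matrix.det_mul]
    exact hM'.mul hM
  · rw [Matrix.det_mul]
    exact hN.mul hN'

theorem MatEquiv.symm {F G : Matrix (Fin l) (Fin m) R} (h : MatEquiv F G) : MatEquiv G F := by
  obtain ⟨M, N, hM, hN, rfl⟩ := h
  refine ⟨M⁻¹, N⁻¹, M.isUnit_nonsing_inv_det hM, N.isUnit_nonsing_inv_det hN, ?_⟩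
  rw [Matrix.mul_assoc M, Matrix.nonsing_inv_mul_cancel_left _ _ hM,
    Matrix.mul_nonsing_inv_cancel_right _ _ hN]

theorem MatEquiv.minorIdeal_le {F G : Matrix (Fin l) (Fin m) R} (h : MatEquiv F G) (k : ℕ) :
    minorIdeal k G ≤ minorIdeal k F := by
  obtain ⟨M, N, -, -, rfl⟩ := h
  exact (minorIdeal_mul_le_left _ _).trans (minorIdeal_mul_le_right _ _)

theorem MatEquiv.minorIdeal_eq {F G : Matrix (Fin l) (Fin m) R} (h : MatEquiv F G) (k : ℕ) :
    minorIdeal k F = minorIdeal k G :=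
  le_antisymm (h.symm.minorIdeal_le k) (h.minorIdeal_le k)

theorem MatEquiv.smul {F G : Matrix (Fin l) (Fin m) R} (h : MatEquiv F G) (c : R) :
    MatEquiv (c • F) (c • G) := by
  obtain ⟨M, N, hM, hN, rfl⟩ := h
  exact ⟨M, N, hM, hN, by simp⟩

/-- The block diagonal matrix with blocks `c` and `F`. -/
def cornerMat (c : R) (F : Matrix (Fin l) (Fin m) R) : Matrix (Fin (l + 1)) (Fin (m + 1)) R :=
  Matrix.of (Fin.cons (Fin.cons c 0) fun i => Fin.cons 0 (F i))

@[simp]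
theorem cornerMat_zero_zero (c : R) (F : Matrix (Fin l) (Fin m) R) : cornerMat c F 0 0 = c := rfl

@[simp]
theorem cornerMat_zero_succ (c : R) (F : Matrix (Fin l) (Fin m) R) (j : Fin m) :
    cornerMat c F 0 j.succ = 0 := rfl

@[simp]
theorem cornerMat_succ_zero (c : R) (F : Matrix (Fin l) (Fin m) R) (i : Fin l) :
    cornerMat c F i.succ 0 = 0 := rfl

@[simp]
theorem cornerMat_succ_succ (c : R) (F : Matrix (Fin l) (Fin m) R) (i : Fin l) (j : Fin m) :
    cornerMat c F i.succ j.succ = F i j := rfl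

theorem ext_fin_succ {R : Type*} {l m : ℕ} {A B : Matrix (Fin (l + 1)) (Fin (m + 1)) R}
    (h₀ : A 0 0 = B 0 0)
    (h₁ : ∀ j : Fin m, A 0 j.succ = B 0 j.succ) (h₂ : ∀ i : Fin l, A i.succ 0 = B i.succ 0)
    (h₃ : ∀ (i : Fin l) (j : Fin m), A i.succ j.succ = B i.succ j.succ) : A = B := by
  ext i j
  refine Fin.cases ?_ (fun i => ?_) i <;> refine Fin.cases ?_ (fun j => ?_) j
  exacts [h₀, h₁ j, h₂ i, h₃ i j]

theorem cornerMat_mul {n : ℕ} (a b : R) (A : Matrix (Fin l) (Fin m) R)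
    (B : Matrix (Fin m) (Fin n) R) :
    cornerMat a A * cornerMat b B = cornerMat (a * b) (A * B) := by
  apply ext_fin_succ <;> intros <;> simp [Matrix.mul_apply, Fin.sum_univ_succ]

theorem smul_cornerMat (c a : R) (A : Matrix (Fin l) (Fin m) R) :
    c • cornerMat a A = cornerMat (c * a) (c • A) := by
  apply ext_fin_succ <;> intros <;> simp

theorem det_cornerMat (c : R) (A : Matrix (Fin l) (Fin l) R) :
    (cornerMat c A).det = c * A.det := by
  rw [Matrix.det_succ_row_zero, Fin.sum_univ_succ]
  have : (cornerMat c A).submatrix Fin.succ (Fin.succAbove 0) = A := by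
    ext
    simp
  rw [this]
  simp

theorem MatEquiv.cornerMat {F G : Matrix (Fin l) (Fin m) R} (h : MatEquiv F G) (c : R) :
    MatEquiv (cornerMat c F) (cornerMat c G) := by
  obtain ⟨M, N, hM, hN, rfl⟩ := h
  refine ⟨_root_.cornerMat 1 M, _root_.cornerMat 1 N, ?_, ?_, ?_⟩
  · rwa [det_cornerMat, one_mul]
  · rwa [det_cornerMat, one_mul]
  · simp [cornerMat_mul]

theorem minorIdeal_succ_cornerMat (k : ℕ) (F : Matrix (Fin l) (Fin m) R) :
    minorIdeal (k + 1) (cornerMat 1 F) = minorIdeal k F := by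
  apply le_antisymm
  · have key : ∀ {k : ℕ} (ri : Fin k → Fin (l + 1)) (ci : Fin k → Fin (m + 1)),
        (∀ a, ri a ≠ 0) → ((cornerMat 1 F).submatrix ri ci).det ∈ minorIdeal k F := by
      intro k ri ci hri
      choose ri' hri' using fun a => Fin.exists_succ_eq.2 (hri a)
      obtain rfl : Fin.succ ∘ ri' = ri := funext hri'
      have : (cornerMat 1 F).submatrix Fin.succ id =
          F * (1 : Matrix (Fin (m + 1)) (Fin (m + 1)) R).submatrix Fin.succ id := by
        ext i j
        refine Fin.cases ?_ (fun j => ?_) j <;> simp [Matrix.mul_apply, Matrix.one_apply]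
      refine minorIdeal_mul_le_left F
        ((1 : Matrix (Fin (m + 1)) (Fin (m + 1)) R).submatrix Fin.succ id) ?_
      rw [← this]
      exact det_submatrix_mem_minorIdeal _ ri' ci
    refine minorIdeal_le_of_injective fun ri ci hri _ => ?_
    by_cases h : ∃ a, ri a = 0
    · obtain ⟨a, ha⟩ := h
      rw [Matrix.det_succ_row _ a]
      refine sum_mem fun j _ => Ideal.mul_mem_left _ _ ?_
      rw [Matrix.submatrix_submatrix]
      exact key _ _ fun b hb => Fin.succAbove_ne a b (hri (hb.trans ha.symm))
    · exact minorIdeal_succ_le F (key ri ci (not_exists.1 h))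
  · refine minorIdeal_le fun ri ci => ?_
    have h : (cornerMat 1 F).submatrix (Fin.cons 0 (Fin.succ ∘ ri)) (Fin.cons 0 (Fin.succ ∘ ci)) =
        cornerMat 1 (F.submatrix ri ci) := by
      apply ext_fin_succ <;> intros <;> simp
    rw [← one_mul (F.submatrix ri ci).det, ← det_cornerMat, ← h]
    exact det_submatrix_mem_minorIdeal _ _ _

theorem IdempotentsSplit.exists_matEquiv_cornerMat [Nontrivial R] (hR : IdempotentsSplit R)
    {F : Matrix (Fin (l + 1)) (Fin (m + 1)) R} {u : Fin (l + 1) → R} {v : Fin (m + 1) → R}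
    (h : u ⬝ᵥ (F *ᵥ v) = 1) : ∃ G : Matrix (Fin l) (Fin m) R, MatEquiv F (cornerMat 1 G) := by
  obtain ⟨g, g', hg, hgu, hgw⟩ := hR.exists_completion h
  obtain ⟨e, e', he, heu, hev⟩ := hR.exists_completion (u := u ᵥ* F) (w := v)
    (by rwa [← Matrix.dotProduct_mulVec])
  have hcol : ∀ i, (g * F * e') i 0 = (Pi.single 0 1 : Fin (l + 1) → R) i := by
    intro i
    rw [← mulVec_eq_single_of_mul_eq_one hg hgw, Matrix.mulVec_mulVec]
    simp only [Matrix.mul_apply (M := g * F), hev]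
    rfl
  have hrow : ∀ j, (g * F * e') 0 j = (1 : Matrix (Fin (m + 1)) (Fin (m + 1)) R) 0 j := by
    intro j
    rw [← he, Matrix.mul_apply, Matrix.mul_apply]
    refine Finset.sum_congr rfl fun a _ => ?_
    rw [heu, Matrix.mul_apply]
    simp only [hgu]
    rfl
  refine ⟨(g * F * e').submatrix Fin.succ Fin.succ, g, e', ?_, ?_, ?_⟩
  · exact IsUnit.of_mul_eq_one _ (by rw [← Matrix.det_mul, hg, Matrix.det_one])
  · refine IsUnit.of_mul_eq_one e.det ?_
    rw [mul_comm, ← Matrix.det_mul, he, Matrix.det_one]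
  · apply ext_fin_succ
    · rw [hrow]; simp
    · intro j
      rw [hrow, Matrix.one_apply_ne (Fin.succ_ne_zero j).symm]; simp
    · intro i
      rw [hcol]; simp
    · intros; simp

theorem IsRetractPair.matEquiv_smithForm [IsDomain R] (hR : IdempotentsSplit R) {x y : R}
    {σ τ : R →+* R} (h : IsRetractPair x y σ τ) {r : ℕ} :
    ∀ {l m : ℕ} {F : Matrix (Fin l) (Fin m) R} {p q : ℕ → ℕ}, p 0 = 0 → q 0 = 0 →
      (∀ k ≤ r, minorIdeal k F = Ideal.span {x ^ p k * y ^ q k}) → minorIdeal (r + 1) F = ⊥ →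
      MatEquiv F (Matrix.of fun (i : Fin l) (j : Fin m) =>
        if (i : ℕ) = (j : ℕ) ∧ (i : ℕ) < r then
          x ^ (p ((i : ℕ) + 1) - p (i : ℕ)) * y ^ (q ((i : ℕ) + 1) - q (i : ℕ)) else 0) := by
  have hne : ∀ a b, x ^ a * y ^ b ≠ 0 := fun a b =>
    mul_ne_zero (pow_ne_zero _ h.left_ne_zero) (pow_ne_zero _ h.right_ne_zero)
  induction r with
  | zero =>
    intro l m F p q _ _ _ hF'
    refine ⟨1, 1, by simp, by simp, ?_⟩
    ext i j
    have := apply_mem_minorIdeal_one F i j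
    rw [hF'] at this
    simpa using this.symm
  | succ r ih =>
    intro l m F p q hp0 hq0 hF hF'
    have hF1 := hF 1 (by omega)
    have hI1 : minorIdeal 1 F ≠ ⊥ := by
      rw [hF1, Ne, Ideal.span_singleton_eq_bot]
      exact hne _ _
    rcases l with _ | l
    · exact absurd (minorIdeal_eq_bot_of_lt (Or.inl one_pos)) hI1
    rcases m with _ | m
    · exact absurd (minorIdeal_eq_bot_of_lt (Or.inr one_pos)) hI1
    have hdvd : ∀ i j, x ^ p 1 * y ^ q 1 ∣ F i j := fun i j => by
      rw [← Ideal.mem_span_singleton, ← hF1]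
      exact apply_mem_minorIdeal_one F i j
    choose F₁ hF₁ using hdvd
    set c := x ^ p 1 * y ^ q 1 with hc
    obtain rfl : F = c • Matrix.of F₁ := by
      ext i j
      exact hF₁ i j
    generalize Matrix.of F₁ = F₁ at *
    have hle : ∀ k ≤ r + 1, k * p 1 ≤ p k ∧ k * q 1 ≤ q k := by
      intro k hk
      apply h.le_of_dvd
      have := hF k hk
      rw [minorIdeal_smul] at this
      have h2 : Ideal.span {x ^ p k * y ^ q k} ≤ Ideal.span {c ^ k} :=
        this ▸ Ideal.mul_le_left
      rw [Ideal.span_singleton_le_span_singleton, hc, mul_pow, ← pow_mul, ← pow_mul] at h2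
      rwa [mul_comm k, mul_comm k]
    have hF₁' : ∀ k ≤ r + 1, minorIdeal k F₁ =
        Ideal.span {x ^ (p k - k * p 1) * y ^ (q k - k * q 1)} := by
      intro k hk
      refine (Ideal.span_singleton_mul_right_inj (pow_ne_zero k (hne (p 1) (q 1)))).1 ?_
      rw [← minorIdeal_smul, hF k hk, Ideal.span_singleton_mul_span_singleton]
      obtain ⟨a, ha⟩ := Nat.exists_eq_add_of_le (hle k hk).1
      obtain ⟨b, hb⟩ := Nat.exists_eq_add_of_le (hle k hk).2
      rw [ha, hb, Nat.add_sub_cancel_left, Nat.add_sub_cancel_left]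
      congr 2
      ring
    obtain ⟨u, v, huv⟩ := h.exists_unimodular hR (r := r) (p := fun k => p k - k * p 1)
      (q := fun k => q k - k * q 1) (by simp) (by simp) (fun k _ => hF₁' k) (by
        rw [minorIdeal_smul, Ideal.mul_eq_bot, Ideal.span_singleton_eq_bot] at hF'
        exact hF'.resolve_left (pow_ne_zero _ (hne _ _)))
    obtain ⟨G, hG⟩ := hR.exists_matEquiv_cornerMat huv
    have hcG := hG.smul c
    have hmin : ∀ k, Ideal.span {c} * minorIdeal k (c • G) = minorIdeal (k + 1) (c • F₁) := by
      intro k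
      rw [hcG.minorIdeal_eq, minorIdeal_smul, minorIdeal_smul, minorIdeal_succ_cornerMat,
        ← mul_assoc, Ideal.span_singleton_mul_span_singleton, pow_succ']
    rw [smul_cornerMat, mul_one] at hcG
    have hle' : ∀ k ≤ r, p 1 ≤ p (k + 1) ∧ q 1 ≤ q (k + 1) := by
      intro k hk
      have h1 := hle (k + 1) (by omega)
      exact ⟨(Nat.le_mul_of_pos_left _ k.succ_pos).trans h1.1,
        (Nat.le_mul_of_pos_left _ k.succ_pos).trans h1.2⟩
    have := ih (F := c • G) (p := fun k => p (k + 1) - p 1) (q := fun k => q (k + 1) - q 1)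
      (by simp) (by simp) (fun k hk => by
        refine (Ideal.span_singleton_mul_right_inj (hne (p 1) (q 1))).1 ?_
        rw [← hc, hmin, hF (k + 1) (by omega), Ideal.span_singleton_mul_span_singleton, hc]
        obtain ⟨a, ha⟩ := Nat.exists_eq_add_of_le (hle' k hk).1
        obtain ⟨b, hb⟩ := Nat.exists_eq_add_of_le (hle' k hk).2
        rw [ha, hb, Nat.add_sub_cancel_left, Nat.add_sub_cancel_left]
        congr 2
        ring) (by
        have h1 := hmin (r + 1)
        rw [hF', Ideal.mul_eq_bot, Ideal.span_singleton_eq_bot] at h1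
        exact h1.resolve_left (hne _ _))
    convert hcG.trans (this.cornerMat c) using 1
    apply ext_fin_succ
    · simp [hp0, hq0, hc]
    · intro j
      simp
    · intro i
      simp
    · intro i j
      simp only [Matrix.of_apply, cornerMat_succ_succ, Fin.val_succ, Nat.add_right_cancel_iff,
        Nat.add_lt_add_iff_right]
      refine if_ctx_congr Iff.rfl (fun hi => ?_) fun _ => rfl
      have h1 := hle' i (by omega)
      rw [Nat.sub_sub_sub_cancel_right h1.1, Nat.sub_sub_sub_cancel_right h1.2]

end SmithForm

section RetractPair

variable {ι K : Type*} [Field K]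

theorem algHom_eq_of_mem_supported {A : Type*} [CommRing A] [Algebra K A] {s : Set ι}
    {f : MvPolynomial ι K} (hf : f ∈ supported K s) {φ ψ : MvPolynomial ι K →ₐ[K] A}
    (h : ∀ i ∈ s, φ (X i) = ψ (X i)) : φ f = ψ f := by
  have : supported K s ≤ AlgHom.equalizer φ ψ := by
    rw [supported_eq_adjoin_X]
    refine Algebra.adjoin_le ?_
    rintro _ ⟨i, hi, rfl⟩
    exact h i hi
  exact this hf

theorem dvd_sub_algHom {φ : MvPolynomial ι K →ₐ[K] MvPolynomial ι K} {x : MvPolynomial ι K}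
    (h : ∀ i, x ∣ X i - φ (X i)) (f : MvPolynomial ι K) : x ∣ f - φ f := by
  induction f using MvPolynomial.induction_on with
  | C a => rw [← MvPolynomial.algebraMap_eq, AlgHom.commutes, sub_self]; exact dvd_zero x
  | add f g hf hg =>
    rw [map_add, add_sub_add_comm]
    exact dvd_add hf hg
  | mul_X f i hf =>
    have : f * X i - φ (f * X i) = (f - φ f) * X i + φ f * (X i - φ (X i)) := by
      rw [map_mul]; ring
    rw [this]
    exact dvd_add (hf.mul_right _) ((h i).mul_left _)

theorem X_sub_ne_zero_of_mem_supported {v : ι} {s : Set ι} (hv : v ∉ s) {f : MvPolynomial ι K}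
    (hf : f ∈ supported K s) : X v - f ≠ 0 := by
  intro h
  rw [← sub_eq_zero.1 h] at hf
  exact hv (X_mem_supported.1 hf)

theorem exists_isRetractPair {v₁ v₂ : ι} (hv : v₁ ≠ v₂) {f₁ f₂ : MvPolynomial ι K}
    (hf₁ : f₁ ∈ supported K ({v₁} : Set ι)ᶜ) (hf₂ : f₂ ∈ supported K ({v₁, v₂} : Set ι)ᶜ) :
    ∃ σ τ : MvPolynomial ι K →+* MvPolynomial ι K,
      IsRetractPair (X v₁ - f₁) (X v₂ - f₂) σ τ := by
  classical
  obtain ⟨σ, hσ₁, hσ⟩ : ∃ σ : MvPolynomial ι K →ₐ[K] MvPolynomial ι K,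
      σ (X v₁) = f₁ ∧ ∀ i, i ≠ v₁ → σ (X i) = X i :=
    ⟨aeval (Function.update X v₁ f₁), by simp, fun i hi => by simp [hi]⟩
  obtain ⟨ρ, hρ₂, hρ⟩ : ∃ ρ : MvPolynomial ι K →ₐ[K] MvPolynomial ι K,
      ρ (X v₂) = f₂ ∧ ∀ i, i ≠ v₂ → ρ (X i) = X i :=
    ⟨aeval (Function.update X v₂ f₂), by simp, fun i hi => by simp [hi]⟩
  obtain ⟨τ, hτ₁, hτ₂, hτ⟩ : ∃ τ : MvPolynomial ι K →ₐ[K] MvPolynomial ι K,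
      τ (X v₁) = X v₁ - f₁ + ρ f₁ ∧ τ (X v₂) = f₂ ∧ ∀ i, i ≠ v₁ → i ≠ v₂ → τ (X i) = X i :=
    ⟨aeval (Function.update (Function.update X v₂ f₂) v₁ (X v₁ - f₁ + ρ f₁)), by simp,
      by simp [hv.symm], fun i hi hi' => by simp [hi, hi']⟩
  have hσf₁ : σ f₁ = f₁ := algHom_eq_of_mem_supported (ψ := AlgHom.id K _) hf₁ hσ
  have hσf₂ : σ f₂ = f₂ := algHom_eq_of_mem_supported (ψ := AlgHom.id K _) hf₂
    fun i hi => hσ i fun h => hi (Or.inl h)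
  have hτf₂ : τ f₂ = f₂ := algHom_eq_of_mem_supported (ψ := AlgHom.id K _) hf₂
    fun i hi => hτ i (fun h => hi (Or.inl h)) fun h => hi (Or.inr h)
  have hτf₁ : τ f₁ = ρ f₁ := algHom_eq_of_mem_supported hf₁ fun i hi => by
    by_cases h : i = v₂
    · rw [h, hτ₂, hρ₂]
    · rw [hτ i hi h, hρ i h]
  have hσρ : σ (ρ f₁) = ρ f₁ := by
    refine algHom_eq_of_mem_supported (φ := σ.comp ρ) hf₁ fun i hi => ?_
    rw [AlgHom.comp_apply]
    by_cases h : i = v₂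
    · rw [h, hρ₂, hσf₂]
    · rw [hρ i h, hσ i hi]
  have hρd : ∀ f, X v₂ - f₂ ∣ f - ρ f := dvd_sub_algHom fun i => by
    by_cases h : i = v₂
    · rw [h, hρ₂]
    · rw [hρ i h, sub_self]
      exact dvd_zero _
  refine ⟨σ, τ, ?_, ?_, ?_, ?_, ?_, ?_, ?_, ?_, ?_⟩
  · exact X_sub_ne_zero_of_mem_supported (by simp) hf₁
  · exact X_sub_ne_zero_of_mem_supported (by simp) hf₂
  · rw [RingHom.coe_coe, map_sub, hσ₁, hσf₁, sub_self]
  · rw [RingHom.coe_coe, map_sub, hσ v₂ hv.symm, hσf₂]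
  · rw [RingHom.coe_coe, map_sub, hτ₁, hτf₁, add_sub_cancel_right]
  · rw [RingHom.coe_coe, map_sub, hτ₂, hτf₂, sub_self]
  · refine dvd_sub_algHom fun i => ?_
    by_cases h : i = v₁
    · rw [h, hσ₁]
    · rw [hσ i h, sub_self]
      exact dvd_zero _
  · refine dvd_sub_algHom fun i => ?_
    by_cases h : i = v₁
    · rw [h, hτ₁, show X v₁ - (X v₁ - f₁ + ρ f₁) = f₁ - ρ f₁ by ring]
      exact hρd f₁
    by_cases h' : i = v₂
    · rw [h', hτ₂]
    · rw [hτ i h h', sub_self]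
      exact dvd_zero _
  · refine fun a => DFunLike.congr_fun (MvPolynomial.algHom_ext (f := σ.comp τ) (g := τ.comp σ)
      fun i => ?_) a
    rw [AlgHom.comp_apply, AlgHom.comp_apply]
    by_cases h : i = v₁
    · rw [h, hτ₁, hσ₁, hτf₁, map_add, map_sub, hσ₁, hσf₁, hσρ, sub_self, zero_add]
    by_cases h' : i = v₂
    · rw [h', hτ₂, hσ v₂ hv.symm, hτ₂, hσf₂]
    · rw [hτ i h h', hσ i h, hτ i h h']

end RetractPair

section Minors

variable {R : Type*} [CommRing R] {l m k : ℕ}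

theorem span_minorsSet (F : Matrix (Fin l) (Fin m) R) :
    Ideal.span (minorsSet k F) = minorIdeal k F := by
  apply le_antisymm
  · refine Ideal.span_le.2 ?_
    rintro _ ⟨ri, ci, -, -, rfl⟩
    exact det_submatrix_mem_minorIdeal F ri ci
  · exact minorIdeal_le_of_injective fun ri ci hr hc => Ideal.subset_span ⟨ri, ci, hr, hc, rfl⟩

theorem forall_minorsSet_dvd_iff {F : Matrix (Fin l) (Fin m) R} {d : R} :
    (∀ a ∈ minorsSet k F, d ∣ a) ↔ minorIdeal k F ≤ Ideal.span {d} := by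
  rw [← span_minorsSet, Ideal.span_le]
  exact forall₂_congr fun a _ => Ideal.mem_span_singleton.symm

theorem JEqTop.exists_minorIdeal_eq {F : Matrix (Fin l) (Fin m) R} (h : JEqTop k F) :
    ∃ d, IsGcdMinors k F d ∧ minorIdeal k F = Ideal.span {d} := by
  obtain ⟨d, hd, hspan⟩ := h
  refine ⟨d, hd, le_antisymm (forall_minorsSet_dvd_iff.1 hd.1) ?_⟩
  rw [Ideal.span_singleton_le_iff_mem, ← span_minorsSet]
  have : ∀ b ∈ Ideal.span {b : R | d * b ∈ minorsSet k F},
      d * b ∈ Ideal.span (minorsSet k F) := by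
    intro b hb
    induction hb using Submodule.span_induction with
    | mem b hb => exact Ideal.subset_span hb
    | zero => simp
    | add a b _ _ ha hb => rw [mul_add]; exact add_mem ha hb
    | smul c b _ hb => rw [smul_eq_mul, mul_left_comm]; exact Ideal.mul_mem_left _ _ hb
  simpa using this 1 (by rw [hspan]; trivial)

theorem jEqTop_of_minorIdeal_eq [IsDomain R] {F : Matrix (Fin l) (Fin m) R} {d : R} (hd : d ≠ 0)
    (h : minorIdeal k F = Ideal.span {d}) : JEqTop k F := by
  have hdvd := forall_minorsSet_dvd_iff.2 h.le
  refine ⟨d, ⟨hdvd, fun e he => ?_⟩, ?_⟩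
  · rwa [forall_minorsSet_dvd_iff, h, Ideal.span_singleton_le_span_singleton] at he
  · have h1 : Ideal.span {d} * Ideal.span {b : R | d * b ∈ minorsSet k F} =
        Ideal.span {d} * ⊤ := by
      rw [Ideal.span_mul_span', Set.singleton_mul, Ideal.mul_top, ← h, ← span_minorsSet]
      congr 1
      ext a
      constructor
      · rintro ⟨b, hb, rfl⟩
        exact hb
      · intro ha
        obtain ⟨b, rfl⟩ := hdvd a ha
        exact ⟨b, ha, rfl⟩
    exact (Ideal.span_singleton_mul_right_inj hd).1 h1

theorem exists_gcd_of_finite [IsDomain R] [UniqueFactorizationMonoid R] {S : Set R}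
    (hS : S.Finite) : ∃ d, (∀ a ∈ S, d ∣ a) ∧ ∀ e, (∀ a ∈ S, e ∣ a) → e ∣ d := by
  classical
  let _ := UniqueFactorizationMonoid.toGCDMonoid R
  induction S, hS using Set.Finite.induction_on with
  | empty => exact ⟨0, by simp, fun e _ => dvd_zero e⟩
  | @insert b S _ _ ih =>
    obtain ⟨d, h1, h2⟩ := ih
    refine ⟨gcd b d, ?_, fun e he => ?_⟩
    · rintro a (rfl | ha)
      · exact gcd_dvd_left _ _
      · exact (gcd_dvd_right _ _).trans (h1 a ha)
    · exact dvd_gcd (he b (Set.mem_insert _ _))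
        (h2 e fun a ha => he a (Set.mem_insert_of_mem _ ha))

theorem exists_isGcdMinors [IsDomain R] [UniqueFactorizationMonoid R] (k : ℕ)
    (F : Matrix (Fin l) (Fin m) R) : ∃ d, IsGcdMinors k F d := by
  refine exists_gcd_of_finite ((Set.finite_range fun s : (Fin k → Fin l) × (Fin k → Fin m) =>
    (F.submatrix s.1 s.2).det).subset ?_)
  rintro _ ⟨ri, ci, -, -, rfl⟩
  exact ⟨(ri, ci), rfl⟩

theorem minorIdeal_eq_bot_of_rank_lt [IsDomain R] {F : Matrix (Fin l) (Fin m) R}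
    (h : (F.map (algebraMap R (FractionRing R))).rank < k) : minorIdeal k F = ⊥ := by
  refine le_bot_iff.1 (minorIdeal_le fun ri ci => ?_)
  by_contra hne
  have h1 : ((F.map (algebraMap R (FractionRing R))).submatrix ri ci).det ≠ 0 := by
    have := (map_ne_zero_iff (algebraMap R (FractionRing R)) (IsFractionRing.injective _ _)).2 hne
    rwa [RingHom.map_det] at this
  have h2 := Matrix.rank_of_det_ne_zero h1
  have h3 := Matrix.rank_submatrix_le (F.map (algebraMap R (FractionRing R))) ri ci
  rw [h2, Fintype.card_fin] at h3
  omega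

theorem prod_mem_minorIdeal_diagonal {r : ℕ} (a : ℕ → R) (hl : k ≤ l) (hm : k ≤ m)
    (hk : k ≤ r) : ∏ i ∈ Finset.range k, a i ∈
      minorIdeal k (Matrix.of fun (i : Fin l) (j : Fin m) =>
        if (i : ℕ) = (j : ℕ) ∧ (i : ℕ) < r then a i else 0) := by
  have := det_submatrix_mem_minorIdeal (Matrix.of fun (i : Fin l) (j : Fin m) =>
    if (i : ℕ) = (j : ℕ) ∧ (i : ℕ) < r then a i else 0) (Fin.castLE hl) (Fin.castLE hm)
  rw [← Fin.prod_univ_eq_prod_range, ← Matrix.det_diagonal]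
  convert this using 2
  ext i j
  have hi : (i : ℕ) < r := i.2.trans_le hk
  simp [Matrix.diagonal_apply, hi, Fin.ext_iff]

theorem prod_pow_sub_mul_pow_sub {p q : ℕ → ℕ} (hp0 : p 0 = 0) (hq0 : q 0 = 0) (x y : R) (k : ℕ)
    (hp : ∀ i < k, p i ≤ p (i + 1)) (hq : ∀ i < k, q i ≤ q (i + 1)) :
    ∏ i ∈ Finset.range k, x ^ (p (i + 1) - p i) * y ^ (q (i + 1) - q i) = x ^ p k * y ^ q k := by
  induction k with
  | zero => simp [hp0, hq0]
  | succ k ih =>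
    rw [Finset.prod_range_succ, ih (fun i hi => hp i (by omega)) fun i hi => hq i (by omega)]
    obtain ⟨a, ha⟩ := Nat.exists_eq_add_of_le (hp k (by omega))
    obtain ⟨b, hb⟩ := Nat.exists_eq_add_of_le (hq k (by omega))
    rw [ha, hb, Nat.add_sub_cancel_left, Nat.add_sub_cancel_left]
    ring

end Minors

/-- Let `F ∈ R^{l×m}` be of normal rank `r` with `d_r(F)` associated to
`d₁^p d₂^q`, `d₁ = x₁ - f₁(x₂,…,xₙ)`, `d₂ = x₂ - f₂(x₃,…,xₙ)` (`p, q > 0`), and `d_i(F)`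
associated to `d₁^{p_i}d₂^{q_i}` for `i = 1,…,r`.  Then `F` is equivalent to its Smith
normal form `[[diag(d₁^{r_1}d₂^{s_1},…,d₁^{r_r}d₂^{s_r}), 0],[0, 0]]`
(`r_i = p_i - p_{i-1}`, `s_i = q_i - q_{i-1}`, `p_0 = q_0 = 0`) if and only if
`J_k(F) = R` for `k = 1,…,r`. -/
theorem statement19 {K : Type*} [Field K] {n l m r : ℕ}
    (v1 v2 : Fin n) (hv1 : (v1 : ℕ) = 0) (hv2 : (v2 : ℕ) = 1)
    (f1 f2 : MvPolynomial (Fin n) K)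
    (hf1 : f1 ∈ MvPolynomial.supported K (({v1} : Set (Fin n))ᶜ))
    (hf2 : f2 ∈ MvPolynomial.supported K (({v1, v2} : Set (Fin n))ᶜ))
    (F : Matrix (Fin l) (Fin m) (MvPolynomial (Fin n) K))
    (hrank : normalRank F = r)
    (p q : ℕ) (hp : 0 < p) (hq : 0 < q)
    (pk qk : ℕ → ℕ) (hpk0 : pk 0 = 0) (hqk0 : qk 0 = 0)
    (hpr : pk r = p) (hqr : qk r = q)
    (hd : ∀ i, 1 ≤ i → i ≤ r → ∀ d, IsGcdMinors i F d →
      Associated d ((X v1 - f1) ^ pk i * (X v2 - f2) ^ qk i)) :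
    MatEquiv F (Matrix.of fun (i : Fin l) (j : Fin m) =>
      if (i : ℕ) = (j : ℕ) ∧ (i : ℕ) < r then
        (X v1 - f1) ^ (pk ((i : ℕ) + 1) - pk (i : ℕ)) *
          (X v2 - f2) ^ (qk ((i : ℕ) + 1) - qk (i : ℕ))
      else 0) ↔
    ∀ k, 1 ≤ k → k ≤ r → JEqTop k F := by

  have hv : v1 ≠ v2 := by
    rintro rfl
    omega
  obtain ⟨σ, τ, h⟩ := exists_isRetractPair hv hf1 hf2
  set x := X v1 - f1
  set y := X v2 - f2
  clear_value x y
  have hbot : minorIdeal (r + 1) F = ⊥ := by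
    apply minorIdeal_eq_bot_of_rank_lt
    change normalRank F < _
    omega
  constructor
  · intro hequiv k hk1 hkr
    have hgcd : ∀ i ≤ r, ∃ d, IsGcdMinors i F d ∧ Associated d (x ^ pk i * y ^ qk i) := by
      intro i hi
      obtain ⟨d, hdi⟩ := exists_isGcdMinors i F
      refine ⟨d, hdi, ?_⟩
      rcases Nat.eq_zero_or_pos i with rfl | hi0
      · rw [hpk0, hqk0, pow_zero, pow_zero, mul_one, associated_one_iff_isUnit,
          ← Ideal.span_singleton_eq_top, eq_top_iff, ← minorIdeal_zero F]
        exact forall_minorsSet_dvd_iff.1 hdi.1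
      · exact hd i hi0 hi d hdi
    have hmono : ∀ i < r, pk i ≤ pk (i + 1) ∧ qk i ≤ qk (i + 1) := by
      intro i hi
      obtain ⟨d, hdi, had⟩ := hgcd i hi.le
      obtain ⟨e, hei, hae⟩ := hgcd (i + 1) hi
      refine h.le_of_dvd (had.dvd_iff_dvd_left.1 (hae.dvd_iff_dvd_right.1 (hei.2 d ?_)))
      rw [forall_minorsSet_dvd_iff]
      exact (minorIdeal_succ_le F).trans (forall_minorsSet_dvd_iff.1 hdi.1)
    have hl : r ≤ l := hrank ▸ Matrix.rank_le_height _
    have hm : r ≤ m := hrank ▸ Matrix.rank_le_width _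
    obtain ⟨d, hdk, had⟩ := hgcd k hkr
    refine jEqTop_of_minorIdeal_eq (d := x ^ pk k * y ^ qk k)
      (mul_ne_zero (pow_ne_zero _ h.left_ne_zero) (pow_ne_zero _ h.right_ne_zero))
      (le_antisymm ?_ ?_)
    · rw [← Ideal.span_singleton_eq_span_singleton.2 had]
      exact forall_minorsSet_dvd_iff.1 hdk.1
    · rw [Ideal.span_singleton_le_iff_mem, hequiv.minorIdeal_eq,
        ← prod_pow_sub_mul_pow_sub hpk0 hqk0 x y k (fun i hi => (hmono i (by omega)).1)
          fun i hi => (hmono i (by omega)).2]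
      exact prod_mem_minorIdeal_diagonal
        (fun i => x ^ (pk (i + 1) - pk i) * y ^ (qk (i + 1) - qk i)) (hkr.trans hl)
        (hkr.trans hm) hkr
  · intro hJ
    refine h.matEquiv_smithForm (idempotentsSplit_mvPolynomial (Fin n) K) hpk0 hqk0
      (fun k hk => ?_) hbot
    rcases Nat.eq_zero_or_pos k with rfl | hk0
    · rw [minorIdeal_zero, hpk0, hqk0]
      simp
    · obtain ⟨d, hdk, hI⟩ := (hJ k hk0 hk).exists_minorIdeal_eq
      rw [hI, Ideal.span_singleton_eq_span_singleton]
      exact hd k hk0 hk d hdk
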